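/- It is undecidable whether the canonical map from a finite pree to its universal group is an embedding: there is no algorithm (computable function) which, given as input a finite pree P presented explicitly as a partial multiplication table on the set {0, 1, …, n−1} together with its identity element and inverse function, decides whether the canonical map π : P → U(P) is injective. Formally, the predicate on (encodings of) finite prees given by "π : P → U(P) is injective" is not a computable predicate. -/

import Mathlib

/-- A pree: a set with identity, involutive inverse, and a partial multiplication
(represented as an `Option`-valued multiplication) satisfying the pree axioms. -/
structure Pree (α : Type*) where
  one : α
  inv : α → α
  mul : α → α → Option α
  one_mul' : ∀ a, mul one a = some a
  mul_one' : ∀ a, mul a one = some a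
  inv_inv' : ∀ a, inv (inv a) = a
  mul_inv' : ∀ a, mul a (inv a) = some one
  inv_mul' : ∀ a, mul (inv a) a = some one
  assoc_defined : ∀ {a b c x y : α}, mul a b = some x → mul b c = some y →
    ((mul x c).isSome ↔ (mul a y).isSome)
  assoc_eq : ∀ {a b c x y z : α}, mul a b = some x → mul b c = some y →
    mul x c = some z → mul a y = some z

namespace Pree

variable {α : Type*} (P : Pree α)

/-- The relators `a b c⁻¹` for every product `ab = c` defined in `P`. -/
def rels : Set (FreeGroup α) :=
  {r | ∃ a b c : α, P.mul a b = some c ∧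
    r = FreeGroup.of a * FreeGroup.of b * (FreeGroup.of c)⁻¹}

/-- The universal group `U(P)` of a pree `P`. -/
abbrev UniversalGroup := PresentedGroup P.rels

/-- The canonical map `π : P → U(P)`. -/
def pi (a : α) : P.UniversalGroup := PresentedGroup.of a

/-- Axiom A(4). -/
def A4 : Prop := ∀ a₁ a₂ a₃ a₄ b₁ b₂ b₃ b₄ : α,
  P.mul (P.inv a₁) a₂ = some b₁ → P.mul (P.inv a₂) a₃ = some b₂ →
  P.mul (P.inv a₃) a₄ = some b₃ → P.mul (P.inv a₄) a₁ = some b₄ →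
  (P.mul b₁ b₂).isSome ∨ (P.mul b₂ b₃).isSome ∨ (P.mul b₃ b₄).isSome ∨ (P.mul b₄ b₁).isSome

/-- Axiom A(5). -/
def A5 : Prop := ∀ a₁ a₂ a₃ a₄ a₅ b₁ b₂ b₃ b₄ b₅ : α,
  P.mul (P.inv a₁) a₂ = some b₁ → P.mul (P.inv a₂) a₃ = some b₂ →
  P.mul (P.inv a₃) a₄ = some b₃ → P.mul (P.inv a₄) a₅ = some b₄ →
  P.mul (P.inv a₅) a₁ = some b₅ →
  (P.mul b₁ b₂).isSome ∨ (P.mul b₂ b₃).isSome ∨ (P.mul b₃ b₄).isSome ∨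
    (P.mul b₄ b₅).isSome ∨ (P.mul b₅ b₁).isSome

/-- A word over `P` is reducible if the product of two successive letters is defined. -/
def Reducible (w : List α) : Prop :=
  ∃ (u : List α) (a b : α) (v : List α), w = u ++ a :: b :: v ∧ (P.mul a b).isSome

/-- The element of `U(P)` represented by a word over `P`. -/
def wordProd (w : List α) : P.UniversalGroup := (w.map P.pi).prod

end Pree

/-- An encoding of a finite pree on the set `{0, …, n−1}`: the size `n`, the identity
element, the inverse function given as a list of length `n`, and the partial multiplication
given as an `n × n` table of `Option ℕ` entries. -/
abbrev PreeCode : Type := ℕ × ℕ × List ℕ × List (List (Option ℕ))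

namespace PreeCode

/-- The size of the underlying set of the encoded pree. -/
def size (c : PreeCode) : ℕ := c.1

/-- The identity element of the encoded pree. -/
def oneOf (c : PreeCode) : ℕ := c.2.1

/-- The inverse function of the encoded pree. -/
def invOf (c : PreeCode) (a : ℕ) : ℕ := c.2.2.1.getD a 0

/-- The partial multiplication of the encoded pree, read off from the table. -/
def mulOf (c : PreeCode) (a b : ℕ) : Option ℕ := (c.2.2.2.getD a []).getD b none

/-- The code `c` is a well-formed encoding of a finite pree: the tables have the right
shape and take values in `{0, …, n−1}`, and the pree axioms hold. -/
def IsValid (c : PreeCode) : Prop :=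
  c.oneOf < c.size ∧
  c.2.2.1.length = c.size ∧ (∀ a < c.size, c.invOf a < c.size) ∧
  c.2.2.2.length = c.size ∧ (∀ row ∈ c.2.2.2, row.length = c.size) ∧
  (∀ a b d : ℕ, a < c.size → b < c.size → c.mulOf a b = some d → d < c.size) ∧
  (∀ a < c.size, c.mulOf c.oneOf a = some a) ∧
  (∀ a < c.size, c.mulOf a c.oneOf = some a) ∧
  (∀ a < c.size, c.invOf (c.invOf a) = a) ∧
  (∀ a < c.size, c.mulOf a (c.invOf a) = some c.oneOf) ∧
  (∀ a < c.size, c.mulOf (c.invOf a) a = some c.oneOf) ∧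
  (∀ a b d x y : ℕ, a < c.size → b < c.size → d < c.size →
    c.mulOf a b = some x → c.mulOf b d = some y →
    ((c.mulOf x d).isSome ↔ (c.mulOf a y).isSome)) ∧
  (∀ a b d x y z : ℕ, a < c.size → b < c.size → d < c.size →
    c.mulOf a b = some x → c.mulOf b d = some y →
    c.mulOf x d = some z → c.mulOf a y = some z)

/-- The relators of the universal group of the encoded pree. -/
def relsOf (c : PreeCode) : Set (FreeGroup (Fin c.size)) :=
  {r | ∃ a b d : Fin c.size, c.mulOf a b = some (d : ℕ) ∧
    r = FreeGroup.of a * FreeGroup.of b * (FreeGroup.of d)⁻¹}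

/-- The canonical map from the encoded pree to its universal group. -/
def piOf (c : PreeCode) : Fin c.size → PresentedGroup c.relsOf := PresentedGroup.of

end PreeCode

/-! ### Counter programs -/

namespace CounterProgram

open Finsupp

/-- Structured programs for a machine with counters indexed by `ℕ`. The body of `loop i b` is run
after decrementing the counter `i`, for as long as this counter is positive. -/
inductive Prog
  | skip
  | inc (i : ℕ)
  | seq (a b : Prog)
  | loop (i : ℕ) (b : Prog)

/-- The contents of the counters. -/
abbrev Store := ℕ →₀ ℕ

/-- The input-output relation of a program. -/
inductive Eval : Prog → Store → Store → Prop
  | skip (v) : Eval .skip v v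
  | inc (i v) : Eval (.inc i) v (v + single i 1)
  | seq {a b u v w} : Eval a u v → Eval b v w → Eval (.seq a b) u w
  | exit {i b v} : v i = 0 → Eval (.loop i b) v v
  | step {i b u v w} : Eval b u v → Eval (.loop i b) v w → Eval (.loop i b) (u + single i 1) w

theorem eval_skip {v w : Store} : Eval .skip v w ↔ w = v := by
  constructor
  · rintro ⟨⟩; rfl
  · rintro rfl; exact .skip _

theorem eval_inc {i : ℕ} {v w : Store} : Eval (.inc i) v w ↔ w = v + single i 1 := by
  constructor
  · rintro ⟨⟩; rfl
  · rintro rfl; exact .inc _ _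

theorem eval_seq {a b : Prog} {u w : Store} :
    Eval (.seq a b) u w ↔ ∃ v, Eval a u v ∧ Eval b v w := by
  constructor
  · rintro (_ | _ | ⟨h, h'⟩); exact ⟨_, h, h'⟩
  · rintro ⟨v, h, h'⟩; exact .seq h h'

theorem eval_loop_of_eq_zero {i : ℕ} {b : Prog} {v w : Store} (hv : v i = 0) :
    Eval (.loop i b) v w ↔ w = v := by
  constructor
  · intro h
    cases h with
    | exit => rfl
    | step => simp at hv
  · rintro rfl; exact .exit hv

theorem eval_loop_add {i : ℕ} {b : Prog} {v w : Store} :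
    Eval (.loop i b) (v + single i 1) w ↔ ∃ u, Eval b v u ∧ Eval (.loop i b) u w := by
  constructor
  · intro h
    generalize hx : v + single i 1 = x at h
    cases h with
    | exit h => subst hx; simp at h
    | step h h' => rw [add_left_inj] at hx; subst hx; exact ⟨_, h, h'⟩
  · rintro ⟨u, h₁, h₂⟩; exact .step h₁ h₂

/-- The program `P`, started in `v`, stops in `w` and nowhere else. -/
def Runs (P : Prog) (v w : Store) : Prop := ∀ w', Eval P v w' ↔ w' = w

theorem runs_inc (i : ℕ) (v : Store) : Runs (.inc i) v (v + single i 1) := fun _ => eval_inc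

theorem Runs.seq {a b : Prog} {u v w : Store} (h : Runs a u v) (h' : Runs b v w) :
    Runs (.seq a b) u w := fun w' => by
  simp only [eval_seq, h _, exists_eq_left, h' _]

theorem eval_seq_of_runs {a b : Prog} {u v w : Store} (h : Runs a u v) :
    Eval (.seq a b) u w ↔ Eval b v w := by
  simp only [eval_seq, h _, exists_eq_left]

theorem runs_loop {i : ℕ} {b : Prog} (S : ℕ → Store) (h₀ : ∀ k, S k i = 0)
    (hb : ∀ k j, Runs b (S k + single i j) (S (k + 1) + single i j)) (n : ℕ) :
    ∀ k, Runs (.loop i b) (S k + single i n) (S (k + n)) := by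
  induction n with
  | zero => intro k w; simp [eval_loop_of_eq_zero, h₀]
  | succ n ih =>
    intro k w
    rw [single_add, ← add_assoc, eval_loop_add]
    simp only [hb _ _ _, exists_eq_left]
    rw [ih (k + 1) w, show k + 1 + n = k + (n + 1) by ring]

/-- Reset the counter `a`. -/
def clear (a : ℕ) : Prog := .loop a .skip

theorem runs_clear {a : ℕ} {v : Store} (n : ℕ) (hv : v a = 0) :
    Runs (clear a) (v + single a n) v :=
  runs_loop (fun _ => v) (fun _ => hv) (fun _ _ _ => eval_skip) n 0

/-- Add the counter `a` to the counter `b`, resetting `a`. -/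
def move (a b : ℕ) : Prog := .loop a (.inc b)

theorem runs_move {a b : ℕ} {v : Store} (n : ℕ) (hab : a ≠ b) (hv : v a = 0) :
    Runs (move a b) (v + single a n) (v + single b n) := by
  have := runs_loop (i := a) (b := .inc b) (fun k => v + single b k)
    (fun k => by simp [hv, hab.symm]) (fun k j w => by
      rw [eval_inc, single_add]; exact Eq.congr_right (by abel)) n 0
  simp only [single_zero, add_zero, zero_add] at this
  exact this

/-- Add the counter `a` to the counter `b`, using the counter `s` as scratch space. -/
def copy (a b s : ℕ) : Prog := .seq (.loop a (.seq (.inc b) (.inc s))) (move s a)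

theorem runs_copy {a b s : ℕ} {v : Store} (hab : a ≠ b) (has : a ≠ s) (hbs : b ≠ s)
    (hv : v s = 0) : Runs (copy a b s) v (v + single b (v a)) := by
  obtain ⟨u, n, hu, rfl⟩ : ∃ (u : Store) (n : ℕ), u a = 0 ∧ v = u + single a n :=
    ⟨v.erase a, v a, by simp, by rw [erase_add_single]⟩
  have hn : (u + single a n) a = n := by simp [hu]
  have hus : u s = 0 := by simpa [single_apply, has] using hv
  rw [hn]
  have h₁ := runs_loop (i := a) (b := .seq (.inc b) (.inc s))
    (fun k => u + single b k + single s k)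
    (fun k => by simp [hu, hab.symm, has.symm]) (fun k j => by
      have := (runs_inc b (u + single b k + single s k + single a j)).seq (runs_inc s _)
      convert this using 1
      simp only [single_add]; abel) n 0
  have h₂ := runs_move (a := s) (b := a) (v := u + single b n) n has.symm
    (by simp [hus, hbs])
  simp only [single_zero, add_zero, zero_add] at h₁
  rw [add_right_comm]
  exact h₁.seq h₂

/-- A partial function of `n` variables is computed by a counter program, whatever the counters
`inp` of the arguments and `out` of the result. All counters from `base` on are scratch space. -/
def Computes {n : ℕ} (f : List.Vector ℕ n →. ℕ) : Prop :=
  ∀ (inp : Fin n → ℕ) (out base : ℕ), (∀ i, inp i < base) → out < base → (∀ i, inp i ≠ out) →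
    ∃ P : Prog, ∀ v : Store, (∀ j, base ≤ j → v j = 0) → v out = 0 → ∀ w,
      Eval P v w ↔ ∃ m ∈ f (List.Vector.ofFn fun i => v (inp i)), w = v + single out m

theorem computes_zero : Computes (n := 0) (fun _ => Part.some 0) := by
  intro inp out base _ _ _
  refine ⟨.skip, fun v _ _ w => ?_⟩
  simp [eval_skip]

theorem computes_get {n : ℕ} (i : Fin n) : Computes (fun v => Part.some (v.get i)) := by
  intro inp out base h₁ h₂ h₃
  refine ⟨copy (inp i) out base, fun v hv ho w => ?_⟩
  rw [runs_copy (h₃ i) (h₁ i).ne h₂.ne (hv _ le_rfl) w]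
  simp

theorem computes_succ : Computes (n := 1) (fun v => Part.some v.head.succ) := by
  intro inp out base h₁ h₂ h₃
  refine ⟨.seq (copy (inp 0) out base) (.inc out), fun v hv ho w => ?_⟩
  rw [((runs_copy (h₃ 0) (h₁ 0).ne h₂.ne (hv _ le_rfl)).seq (runs_inc _ _)) w]
  simp [single_add, add_assoc]

/-- The counter contents `m 0, …, m (n - 1)` at the positions `base, …, base + n - 1`. -/
noncomputable def block (base : ℕ) {n : ℕ} (m : Fin n → ℕ) : Store :=
  ∑ i : Fin n, single (base + (i : ℕ)) (m i)

theorem block_apply_add (base : ℕ) {n : ℕ} (m : Fin n → ℕ) (i : Fin n) :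
    block base m (base + i) = m i := by
  simp [block, single_apply, Fin.val_inj]

theorem block_apply_of_lt (base : ℕ) {n : ℕ} (m : Fin n → ℕ) {j : ℕ} (h : j < base) :
    block base m j = 0 := by
  simp only [block, finsetSum_apply, single_apply]
  exact Finset.sum_eq_zero fun i _ => if_neg (by omega)

theorem block_apply_of_ge (base : ℕ) {n : ℕ} (m : Fin n → ℕ) {j : ℕ} (h : base + n ≤ j) :
    block base m j = 0 := by
  simp only [block, finsetSum_apply, single_apply]
  exact Finset.sum_eq_zero fun i _ => if_neg (by omega)

theorem block_castSucc (base : ℕ) {n : ℕ} (m : Fin (n + 1) → ℕ) :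
    block base m = block base (fun i => m i.castSucc) + single (base + n) (m (Fin.last n)) := by
  simp [block, Fin.sum_univ_castSucc]

theorem exists_prog_block {k : ℕ} (inp : Fin k → ℕ) (base : ℕ) (h : ∀ i, inp i < base) (n : ℕ) :
    ∀ (g : Fin n → List.Vector ℕ k →. ℕ), (∀ i, Computes (g i)) →
      ∃ P : Prog, ∀ v : Store, (∀ j, base ≤ j → v j = 0) → ∀ w, Eval P v w ↔
        ∃ m : Fin n → ℕ, (∀ i, m i ∈ g i (List.Vector.ofFn fun i => v (inp i))) ∧
          w = v + block base m := by
  induction n with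
  | zero =>
    intro g _
    exact ⟨.skip, fun v _ w => by simp [eval_skip, block]⟩
  | succ n ih =>
    intro g hg
    obtain ⟨P, hP⟩ := ih (fun i => g i.castSucc) fun i => hg _
    obtain ⟨Q, hQ⟩ := hg (Fin.last n) inp (base + n) (base + n + 1)
      (fun i => by have := h i; omega) (by omega) (fun i => by have := h i; omega)
    refine ⟨.seq P Q, fun v hv w => ?_⟩
    have key : ∀ m : Fin n → ℕ, ∀ w, Eval Q (v + block base m) w ↔
        ∃ a ∈ g (Fin.last n) (List.Vector.ofFn fun i => v (inp i)),
          w = v + block base m + single (base + n) a := by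
      intro m w
      rw [hQ _ (fun j hj => by
        simp [hv j (by omega), block_apply_of_ge base m (j := j) (by omega)])
        (by simp [hv (base + n) (by omega), block_apply_of_ge])]
      simp [block_apply_of_lt, h]
    simp only [eval_seq, hP v hv]
    constructor
    · rintro ⟨_, ⟨m, hm, rfl⟩, h'⟩
      obtain ⟨a, ha, rfl⟩ := (key m w).1 h'
      refine ⟨Fin.snoc m a, fun i => ?_, ?_⟩
      · refine Fin.lastCases ?_ (fun i => ?_) i
        · simpa using ha
        · simpa using hm i
      · simp [block_castSucc, add_assoc]
    · rintro ⟨m, hm, rfl⟩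
      refine ⟨_, ⟨fun i => m i.castSucc, fun i => hm _, rfl⟩, (key _ _).2
        ⟨_, hm _, by rw [block_castSucc, add_assoc]⟩⟩

theorem exists_prog_clear (base n : ℕ) : ∃ P : Prog, ∀ (v : Store) (m : Fin n → ℕ),
    (∀ i : Fin n, v (base + i) = 0) → Runs P (v + block base m) v := by
  induction n with
  | zero => exact ⟨.skip, fun v m _ w => by simp [eval_skip, block]⟩
  | succ n ih =>
    obtain ⟨P, hP⟩ := ih
    refine ⟨.seq (clear (base + n)) P, fun v m hv => ?_⟩
    rw [block_castSucc, ← add_assoc]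
    have h := hv (Fin.last n)
    exact (runs_clear _ (by simpa [block_apply_of_ge] using h)).seq
      (hP v _ fun i => hv i.castSucc)

theorem computes_comp {k n : ℕ} {f : List.Vector ℕ n →. ℕ} {g : Fin n → List.Vector ℕ k →. ℕ}
    (hf : Computes f) (hg : ∀ i, Computes (g i)) {F : List.Vector ℕ k →. ℕ}
    (hF : ∀ v a, a ∈ F v ↔ ∃ m : Fin n → ℕ, (∀ i, m i ∈ g i v) ∧ a ∈ f (List.Vector.ofFn m)) :
    Computes F := by
  intro inp out base h₁ h₂ h₃
  obtain ⟨P, hP⟩ := exists_prog_block inp base h₁ n g hg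
  obtain ⟨Q, hQ⟩ := hf (fun i => base + i) out (base + n) (fun i => by omega) (by omega)
    (fun i => by omega)
  obtain ⟨R, hR⟩ := exists_prog_clear base n
  refine ⟨.seq P (.seq Q R), fun v hv ho w => ?_⟩
  have key : ∀ (m : Fin n → ℕ) w, Eval (.seq Q R) (v + block base m) w ↔
      ∃ a ∈ f (List.Vector.ofFn m), w = v + single out a := by
    intro m w
    have hQ' := hQ (v + block base m) (fun j hj => by
      simp [hv j (by omega), block_apply_of_ge base m hj])
      (by simp [ho, block_apply_of_lt base m h₂])
    have hm : (fun i : Fin n => (v + block base m) (base + i)) = m := by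
      funext i; simp [hv, block_apply_add]
    rw [hm] at hQ'
    have hR' : ∀ a, Runs R (v + block base m + single out a) (v + single out a) := fun a => by
      rw [add_right_comm]
      exact hR _ m fun i => by simp [hv, single_apply]; omega
    simp only [eval_seq, hQ']
    constructor
    · rintro ⟨_, ⟨a, ha, rfl⟩, h⟩
      exact ⟨a, ha, (hR' a w).1 h⟩
    · rintro ⟨a, ha, rfl⟩
      exact ⟨_, ⟨a, ha, rfl⟩, (hR' a _).2 rfl⟩
  simp only [eval_seq (a := P), hP v hv, hF]
  constructor
  · rintro ⟨_, ⟨m, hm, rfl⟩, h⟩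
    obtain ⟨a, ha, rfl⟩ := (key m w).1 h
    exact ⟨a, ⟨m, hm, ha⟩, rfl⟩
  · rintro ⟨a, ⟨m, hm, ha⟩, rfl⟩
    exact ⟨_, ⟨m, hm, rfl⟩, (key m _).2 ⟨a, ha, rfl⟩⟩

theorem computes_prec {n : ℕ} {f : List.Vector ℕ n → ℕ} {g : List.Vector ℕ (n + 2) → ℕ}
    (hf : Computes fun v => Part.some (f v)) (hg : Computes fun v => Part.some (g v)) :
    Computes fun v : List.Vector ℕ (n + 1) => Part.some
      (v.head.rec (f v.tail) fun y ih => g (y ::ᵥ ih ::ᵥ v.tail) : ℕ) := by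
  intro inp out base h₁ h₂ h₃
  obtain ⟨P, hP⟩ := hf (fun i => inp i.succ) out (base + 3)
    (fun i => by have := h₁ i.succ; omega) (by omega) (fun i => h₃ _)
  obtain ⟨Q, hQ⟩ := hg (Fin.cons (base + 1) (Fin.cons out fun i => inp i.succ)) (base + 2)
    (base + 3)
    (by
      refine Fin.cases (by simp) (Fin.cases (by simp; omega) fun i => ?_)
      have := h₁ i.succ
      simp only [Fin.cons_succ]; omega) (by omega)
    (by
      refine Fin.cases (by simp) (Fin.cases (by simp; omega) fun i => ?_)
      have := h₁ i.succ
      simp only [Fin.cons_succ]; omega)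
  let body : Prog := .seq Q (.seq (clear out) (.seq (move (base + 2) out) (.inc (base + 1))))
  refine ⟨.seq (copy (inp 0) base (base + 1)) (.seq P (.seq (.loop base body)
    (clear (base + 1)))), fun v hv ho w => ?_⟩
  have hv' : ∀ j, v (base + j) = 0 := fun j => hv _ (by omega)
  have hv₀ : v base = 0 := hv _ le_rfl
  let r : ℕ → ℕ := fun k =>
    k.rec (f (List.Vector.ofFn fun i => v (inp i.succ)))
      fun y ih => g (y ::ᵥ ih ::ᵥ (List.Vector.ofFn fun i => v (inp i.succ)))
  let S : ℕ → Store := fun k => v + single (base + 1) k + single out (r k)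
  have hcopy := runs_copy (a := inp 0) (b := base) (s := base + 1) (v := v)
    (h₁ 0).ne (by have := h₁ 0; omega) (by omega) (hv' 1)
  have hP' : Runs P (v + single base (v (inp 0))) (S 0 + single base (v (inp 0))) := fun w => by
    rw [hP _ (fun j hj => by simp [hv j (by omega), single_apply]; omega)
      (by simp [ho, h₂.ne'])]
    have : ∀ i : Fin n, single base (v (inp 0)) (inp i.succ) = 0 := fun i => by
      simp [(h₁ _).ne]
    simp only [Part.mem_some_iff, exists_eq_left, Finsupp.add_apply, this, add_zero]
    simp only [S, r, single_zero, add_zero]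
    rw [add_right_comm]
    exact Iff.rfl
  have hQ' : ∀ k j, Runs Q (S k + single base j)
      (S k + single base j + single (base + 2) (r (k + 1))) := fun k j w => by
    rw [hQ _ (fun j hj => by simp [S, hv j (by omega), single_apply]; omega)
      (by simp [S, hv', single_apply]; omega)]
    have e₁ : (S k + single base j) (base + 1) = k := by
      simp [S, hv', single_apply]; omega
    have e₂ : (S k + single base j) out = r k := by
      simp [S, ho, show base + 1 ≠ out by omega, h₂.ne']
    have e₃ : ∀ i : Fin n, (S k + single base j) (inp i.succ) = v (inp i.succ) := fun i => by
      have := h₁ i.succ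
      have := h₃ i.succ
      simp [S, show base + 1 ≠ inp i.succ by omega, show base ≠ inp i.succ by omega,
        show out ≠ inp i.succ by omega]
    have : (List.Vector.ofFn fun i => (S k + single base j)
        ((Fin.cons (base + 1) (Fin.cons out fun i => inp i.succ) : Fin (n + 2) → ℕ) i)) =
        k ::ᵥ r k ::ᵥ List.Vector.ofFn fun i => v (inp i.succ) := by
      simp only [List.Vector.ofFn, Fin.cons_zero, Fin.cons_succ, e₁, e₂, e₃]
    rw [this]
    simp [r]
  have hbody : ∀ k j, Runs body (S k + single base j) (S (k + 1) + single base j) := fun k j => by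
    refine (hQ' k j).seq ?_
    have c₁ := runs_clear (a := out) (v := v + single (base + 1) k + single base j +
      single (base + 2) (r (k + 1))) (r k) (by simp [ho, single_apply]; omega)
    have c₂ := runs_move (a := base + 2) (b := out) (v := v + single (base + 1) k + single base j)
      (r (k + 1)) (by omega) (by simp [hv'])
    have c₃ := runs_inc (base + 1) (v + single (base + 1) k + single base j +
      single out (r (k + 1)))
    have := c₁.seq (c₂.seq c₃)
    convert this using 1
    · simp only [S]; abel
    · simp only [S, single_add]; abel
  have hloop := runs_loop S (i := base) (b := body)
    (fun k => by simp [S, hv₀, single_apply]; omega) hbody (v (inp 0)) 0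
  have hclear := runs_clear (a := base + 1) (v := v + single out (r (v (inp 0)))) (v (inp 0))
    (by simp [hv', single_apply]; omega)
  rw [add_right_comm] at hclear
  rw [zero_add] at hloop
  rw [(hcopy.seq (hP'.seq (hloop.seq hclear))) w]
  simp [r, List.Vector.tail_ofFn, List.Vector.head_ofFn]

theorem computes_rfind {n : ℕ} {f : List.Vector ℕ (n + 1) → ℕ}
    (hf : Computes fun v => Part.some (f v)) :
    Computes fun v : List.Vector ℕ n =>
      Nat.rfind fun k => Part.some (decide (f (k ::ᵥ v) = 0)) := by
  intro inp out base h₁ h₂ h₃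
  obtain ⟨Q, hQ⟩ := hf (Fin.cons out inp) base (base + 1)
    (by
      refine Fin.cases (by simp; omega) fun i => ?_
      have := h₁ i
      simp only [Fin.cons_succ]; omega) (by omega)
    (by
      refine Fin.cases (by simp; omega) fun i => ?_
      have := h₁ i
      simp only [Fin.cons_succ]; omega)
  let body : Prog := .seq (clear base) (.seq (.inc out) Q)
  refine ⟨.seq Q (.loop base body), fun v hv ho w => ?_⟩
  have hv₀ : v base = 0 := hv _ le_rfl
  let r : ℕ → ℕ := fun k => f (k ::ᵥ List.Vector.ofFn fun i => v (inp i))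
  let S : ℕ → Store := fun k => v + single out k + single base (r k)
  have hQ' : ∀ k, Runs Q (v + single out k) (S k) := fun k w => by
    rw [hQ _ (fun j hj => by simp [hv j (by omega), single_apply]; omega)
      (by simp [hv₀, h₂.ne'])]
    have : (List.Vector.ofFn fun i => (v + single out k)
        ((Fin.cons out inp : Fin (n + 1) → ℕ) i)) =
        k ::ᵥ List.Vector.ofFn fun i => v (inp i) := by
      have e : ∀ i : Fin n, single out k (inp i) = 0 := fun i => by simp [h₃ i]
      simp [List.Vector.ofFn, ho, e]
    rw [this]
    simp [S, r]
  have hbody : ∀ k c, Runs body (v + single out k + single base c) (S (k + 1)) := fun k c => by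
    refine (runs_clear c (by simp [hv₀, h₂.ne])).seq ((runs_inc _ _).seq ?_)
    rw [add_assoc v, ← single_add]
    exact hQ' (k + 1)
  have hstep : ∀ k w, r k ≠ 0 →
      (Eval (.loop base body) (S k) w ↔ Eval (.loop base body) (S (k + 1)) w) := fun k w hk => by
    obtain ⟨c, hc⟩ := Nat.exists_eq_succ_of_ne_zero hk
    simp only [S, hc, Nat.succ_eq_add_one, single_add _ c 1]
    rw [← add_assoc, eval_loop_add]
    simp only [hbody _ _ _, exists_eq_left]
    rfl
  have hexit : ∀ k w, r k = 0 → (Eval (.loop base body) (S k) w ↔ w = v + single out k) :=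
    fun k w hk => by
      rw [eval_loop_of_eq_zero (by simp [S, hv₀, hk, h₂.ne])]
      simp [S, hk]
  have hforward : ∀ P u w, Eval P u w → ∀ k, P = .loop base body → u = S k →
      ∃ m, (k ≤ m ∧ r m = 0 ∧ ∀ j, k ≤ j → j < m → r j ≠ 0) ∧ w = v + single out m := by
    intro P u w h
    induction h with
    | skip | inc | seq => intro k hP; cases hP
    | @exit i b u hu =>
      intro k hP huS
      cases hP
      subst huS
      have hk : r k = 0 := by simpa [S, hv₀, h₂.ne] using hu
      exact ⟨k, ⟨le_rfl, hk, fun j hj hj' => by omega⟩, by simp [S, hk]⟩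
    | @step i b u u' w hb _ _ ih =>
      intro k hP huS
      cases hP
      have hk : r k ≠ 0 := fun hk => by
        have := DFunLike.congr_fun huS base
        simp [S, hv₀, hk, h₂.ne] at this
      obtain ⟨c, hc⟩ := Nat.exists_eq_succ_of_ne_zero hk
      have hu : u = v + single out k + single base c := by
        simp only [S, hc, Nat.succ_eq_add_one, single_add _ c 1] at huS
        rw [← add_assoc] at huS
        exact add_right_cancel huS
      subst hu
      obtain ⟨m, ⟨h₁, h₂, h₃⟩, rfl⟩ := ih (k + 1) rfl ((hbody _ _ _).1 hb)
      refine ⟨m, ⟨by omega, h₂, fun j hj hj' => ?_⟩, rfl⟩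
      rcases hj.eq_or_lt with rfl | hj
      · exact hk
      · exact h₃ j hj hj'
  have hbackward : ∀ d k, r (k + d) = 0 → (∀ j, k ≤ j → j < k + d → r j ≠ 0) →
      Eval (.loop base body) (S k) (v + single out (k + d)) := by
    intro d
    induction d with
    | zero => intro k hk _; exact (hexit k _ hk).2 rfl
    | succ d ih =>
      intro k hk hj
      rw [hstep k _ (hj k le_rfl (by omega))]
      have := ih (k + 1) (by rw [← hk]; congr 1; ring) fun j h h' => hj j (by omega) (by omega)
      rwa [show k + 1 + d = k + (d + 1) by ring] at this
  have h₀ := hQ' 0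
  rw [single_zero, add_zero] at h₀
  rw [eval_seq_of_runs h₀]
  constructor
  · intro h
    obtain ⟨m, ⟨-, h₁, h₂⟩, rfl⟩ := hforward _ _ _ h 0 rfl rfl
    exact ⟨m, Nat.mem_rfind.2 ⟨by simpa using h₁, fun {j} hj => by
      simpa using h₂ j (Nat.zero_le _) hj⟩, rfl⟩
  · rintro ⟨m, hm, rfl⟩
    obtain ⟨h₁, h₂⟩ := Nat.mem_rfind.1 hm
    have := hbackward m 0 (by simpa using h₁) fun j _ hj => by
      simpa using h₂ (m := j) (by simpa using hj)
    simpa using this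

theorem computes_of_primrec' {n : ℕ} {f : List.Vector ℕ n → ℕ} (hf : Nat.Primrec' f) :
    Computes fun v => Part.some (f v) := by
  induction hf with
  | zero => exact computes_zero
  | succ => exact computes_succ
  | get i => exact computes_get i
  | comp g _ _ hf hg =>
    refine computes_comp hf hg fun v a => ?_
    simp only [Part.mem_some_iff]
    constructor
    · rintro rfl
      exact ⟨_, fun i => rfl, rfl⟩
    · rintro ⟨m, hm, rfl⟩
      rw [funext hm]
  | prec _ _ hf hg => exact computes_prec hf hg

theorem mem_mOfFn {n : ℕ} (g : Fin n → Part ℕ) (m : List.Vector ℕ n) :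
    m ∈ List.Vector.mOfFn g ↔ ∀ i, m.get i ∈ g i := by
  induction n with
  | zero => simp [List.Vector.mOfFn, pure, Part.mem_some_iff, eq_iff_true_of_subsingleton]
  | succ n ih =>
    simp only [List.Vector.mOfFn, Part.bind_eq_bind, Part.mem_bind_iff, ih, Part.pure_eq_some,
      Part.mem_some_iff]
    constructor
    · rintro ⟨a, ha, u, hu, rfl⟩
      exact Fin.cases (by simpa using ha) fun i => by simpa using hu i
    · intro h
      refine ⟨m.head, by simpa using h 0, m.tail, fun i => ?_, by simp⟩
      simpa [List.Vector.get_tail_succ] using h i.succ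

theorem computes_of_partrec' {n : ℕ} {f : List.Vector ℕ n →. ℕ} (hf : Nat.Partrec' f) :
    Computes f := by
  induction hf with
  | prim hf => exact computes_of_primrec' hf
  | comp g _ _ hf hg =>
    refine computes_comp hf hg fun v a => ?_
    refine Part.mem_bind_iff.trans ?_
    simp only [mem_mOfFn]
    constructor
    · rintro ⟨m, hm, ha⟩
      exact ⟨m.get, hm, by rwa [List.Vector.ofFn_get]⟩
    · rintro ⟨m, hm, ha⟩
      exact ⟨_, by simpa using hm, ha⟩
  | rfind _ hf => exact computes_rfind hf

/-- The halting problem of a suitable program, started with an input in the counter `0`, is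
undecidable. -/
theorem exists_undecidable_prog :
    ∃ P : Prog, ¬ ComputablePred fun n : ℕ => Eval P (single 0 n) 0 := by
  have hpart : Partrec fun n : ℕ =>
      Nat.Partrec.Code.eval (Denumerable.ofNat Nat.Partrec.Code n) 0 :=
    Nat.Partrec.Code.eval_part.comp (Computable.ofNat _) (Computable.const 0)
  obtain ⟨P, hP⟩ := computes_of_partrec' (Nat.Partrec'.part_iff₁.2 hpart) (fun _ => 0) 1 2
    (by simp) (by simp) (by simp)
  refine ⟨.seq P (.seq (clear 1) (clear 0)), fun h => ?_⟩
  have key : ∀ n : ℕ, Eval (.seq P (.seq (clear 1) (clear 0))) (single 0 n) 0 ↔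
      (Nat.Partrec.Code.eval (Denumerable.ofNat Nat.Partrec.Code n) 0).Dom := by
    intro n
    have hc : ∀ m, Runs (.seq (clear 1) (clear 0)) (single 0 n + single 1 m) 0 := fun m => by
      have h₀ := runs_clear (a := 0) (v := 0) n rfl
      rw [zero_add] at h₀
      exact (runs_clear m (by simp)).seq h₀
    rw [eval_seq]
    simp only [hP (single 0 n) (fun j hj => by simp [single_apply]; omega) (by simp)]
    constructor
    · rintro ⟨_, ⟨m, hm, -⟩, -⟩
      simp at hm
      exact Part.dom_iff_mem.2 ⟨m, hm⟩
    · intro hd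
      obtain ⟨m, hm⟩ := Part.dom_iff_mem.1 hd
      exact ⟨_, ⟨m, by simpa using hm, rfl⟩, (hc m _).2 rfl⟩
  simp only [key] at h
  refine ComputablePred.halting_problem 0 ?_
  obtain ⟨_, h⟩ := h
  refine ⟨fun c => decidable_of_iff
    (Nat.Partrec.Code.eval (Denumerable.ofNat Nat.Partrec.Code (Encodable.encode c)) 0).Dom
    (by simp), ?_⟩
  refine (h.comp Computable.encode).of_eq fun c => ?_
  simp

end CounterProgram
/-! ### Affine pull-back systems -/

/-- A constraint `u ∈ Y tgt ↔ offset + factor * u ∈ Y src` on a family `Y` of sets of integers. -/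
structure PullRule (State : Type) where
  tgt : State
  src : State
  offset : ℤ
  factor : ℤ

/-- The family `Y` satisfies all constraints in `R`. -/
def PullRule.Sat {State : Type} (R : Set (PullRule State)) (Y : State → Set ℤ) : Prop :=
  ∀ ρ ∈ R, ∀ u : ℤ, u ∈ Y ρ.tgt ↔ ρ.offset + ρ.factor * u ∈ Y ρ.src

/-- The integer `z` is forced into `Y q₀` by the constraints `R` and `1 ∈ Y q₁`. -/
def PullRule.Forced {State : Type} (R : Set (PullRule State)) (q₁ q₀ : State) (z : ℤ) : Prop :=
  ∀ Y : State → Set ℤ, PullRule.Sat R Y → 1 ∈ Y q₁ → z ∈ Y q₀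

namespace CounterProgram

open Finsupp

/-- The prime number encoding the counter `i`. -/
noncomputable def pr (i : ℕ) : ℕ := Nat.nth Nat.Prime i

theorem prime_pr (i : ℕ) : (pr i).Prime := Nat.prime_nth_prime i

theorem pr_injective : Function.Injective pr := Nat.nth_injective Nat.infinite_setOfPred_prime

/-- The Gödel number of a store. -/
noncomputable def enc (v : Store) : ℕ := (v.mapDomain pr).prod (· ^ ·)

theorem factorization_enc (v : Store) : (enc v).factorization = v.mapDomain pr :=
  Nat.prod_pow_factorization_eq_self fun p hp => by
    obtain ⟨i, -, rfl⟩ := Finset.mem_image.1 (mapDomain_support hp)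
    exact prime_pr i

theorem enc_injective : Function.Injective enc := fun v w h =>
  mapDomain_injective pr_injective (by rw [← factorization_enc, h, factorization_enc])

theorem enc_zero : enc 0 = 1 := by simp [enc]

theorem enc_add_single (v : Store) (i : ℕ) : enc (v + single i 1) = pr i * enc v := by
  rw [enc, mapDomain_add, prod_add_index' (by simp) (fun _ => pow_add _), mapDomain_single,
    prod_single_index (by simp), pow_one, mul_comm, enc]

theorem enc_single (n : ℕ) : enc (single 0 n) = 2 ^ n := by
  rw [enc, mapDomain_single, prod_single_index (by simp), pr, Nat.nth_prime_zero_eq_two]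

theorem pr_dvd_enc {v : Store} {i : ℕ} : pr i ∣ enc v ↔ v i ≠ 0 := by
  have h : (enc v).factorization (pr i) = v i := by
    rw [factorization_enc, mapDomain_apply pr_injective]
  have h₀ : enc v ≠ 0 := by
    refine Finset.prod_ne_zero_iff.2 fun p hp => pow_ne_zero _ ?_
    obtain ⟨i, -, rfl⟩ := Finset.mem_image.1 (mapDomain_support hp)
    exact (prime_pr i).ne_zero
  rw [← h, (prime_pr i).dvd_iff_one_le_factorization h₀, Nat.one_le_iff_ne_zero]

theorem exists_of_pr_mul_eq {z : ℤ} {w : Store} {i : ℕ} (h : (pr i : ℤ) * z = enc w) :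
    ∃ v, z = enc v ∧ w = v + single i 1 := by
  have hw : w i ≠ 0 := pr_dvd_enc.1 (by exact_mod_cast Dvd.intro _ h)
  have hv : w = w - single i 1 + single i 1 := by
    ext j
    by_cases hj : i = j
    · subst hj; simp; omega
    · simp [hj]
  refine ⟨_, ?_, hv⟩
  rw [hv, enc_add_single, Nat.cast_mul] at h
  exact mul_left_cancel₀ (by exact_mod_cast (prime_pr i).ne_zero) h

/-- The input-output relation of a sequence of programs. -/
def EvalList : List Prog → Store → Store → Prop
  | [], v, w => v = w
  | P :: c, v, w => ∃ u, Eval P v u ∧ EvalList c u w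

/-- States of the pull-back system of a program: a list of programs still to be run, and an affine
substitution applied before. -/
abbrev State := List Prog × ℤ × ℤ

/-- The state in which the programs `c` are still to be run. -/
abbrev run (c : List Prog) : State := (c, 0, 1)

/-- The rules governing the execution of `P` followed by `c`. -/
noncomputable def rules : Prog → List Prog → Set (PullRule State)
  | .skip, c => {⟨run (.skip :: c), run c, 0, 1⟩}
  | .inc i, c => {⟨run (.inc i :: c), run c, 0, pr i⟩}
  | .seq a b, c => {⟨run (.seq a b :: c), run (a :: b :: c), 0, 1⟩} ∪ rules a (b :: c) ∪ rules b c
  | .loop i b, c =>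
    {⟨run (b :: .loop i b :: c), run (.loop i b :: c), 0, pr i⟩} ∪
    (fun r : ℕ => ⟨(.loop i b :: c, (r : ℤ), (pr i : ℤ)), run (.loop i b :: c), r, pr i⟩) ''
      Set.Ioo 0 (pr i) ∪
    (fun r : ℕ => ⟨(.loop i b :: c, (r : ℤ), (pr i : ℤ)), run c, r, pr i⟩) ''
      Set.Ioo 0 (pr i) ∪
    rules b (.loop i b :: c)

theorem finite_rules (P : Prog) : ∀ c, (rules P c).Finite := by
  induction P with
  | skip | inc => intro c; exact Set.finite_singleton _
  | seq a b iha ihb =>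
    intro c
    exact ((Set.finite_singleton _).union (iha _)).union (ihb _)
  | loop i b ih =>
    intro c
    exact (((Set.finite_singleton _).union ((Set.finite_Ioo _ _).image _)).union
      ((Set.finite_Ioo _ _).image _)).union (ih _)

theorem factor_ne_zero_of_mem_rules (P : Prog) : ∀ c, ∀ ρ ∈ rules P c, ρ.factor ≠ 0 := by
  have hp : ∀ i, (pr i : ℤ) ≠ 0 := fun i => by exact_mod_cast (prime_pr i).ne_zero
  induction P with
  | skip => rintro c _ rfl; exact one_ne_zero
  | inc i => rintro c _ rfl; exact hp i
  | seq a b iha ihb =>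
    rintro c ρ ((rfl | h) | h)
    · exact one_ne_zero
    · exact iha _ _ h
    · exact ihb _ _ h
  | loop i b ih =>
    rintro c ρ (((rfl | ⟨r, -, rfl⟩) | ⟨r, -, rfl⟩) | h)
    · exact hp i
    · exact hp i
    · exact hp i
    · exact ih _ _ h

theorem enc_mem_of_eval {Y : State → Set ℤ} {P : Prog} {v w : Store} (h : Eval P v w) :
    ∀ c, PullRule.Sat (rules P c) Y → (enc w : ℤ) ∈ Y (run c) → (enc v : ℤ) ∈ Y (run (P :: c)) := by
  induction h with
  | skip v =>
    intro c hY hw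
    exact (hY _ rfl _).2 (by simpa using hw)
  | inc i v =>
    intro c hY hw
    exact (hY _ rfl _).2 (by simpa [enc_add_single] using hw)
  | seq _ _ iha ihb =>
    intro c hY hw
    refine (hY _ (.inl (.inl rfl)) _).2 ?_
    simpa using iha _ (fun ρ hρ => hY ρ (.inl (.inr hρ)))
      (ihb _ (fun ρ hρ => hY ρ (.inr hρ)) hw)
  | @exit i b v hv =>
    intro c hY hw
    have hr : enc v % pr i ∈ Set.Ioo 0 (pr i) :=
      ⟨Nat.pos_of_ne_zero fun h => pr_dvd_enc.1 (Nat.dvd_of_mod_eq_zero h) hv,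
        Nat.mod_lt _ (prime_pr i).pos⟩
    have he : (enc v : ℤ) = (enc v % pr i : ℕ) + (pr i : ℤ) * (enc v / pr i : ℕ) := by
      exact_mod_cast (Nat.mod_add_div _ _).symm
    rw [he] at hw ⊢
    exact (hY _ (.inl (.inl (.inr ⟨_, hr, rfl⟩))) _).1
      ((hY _ (.inl (.inr ⟨_, hr, rfl⟩)) _).2 hw)
  | step _ _ ihb ih =>
    intro c hY hw
    have := (hY _ (.inl (.inl (.inl rfl))) _).1 (ihb _ (fun ρ hρ => hY ρ (.inr hρ)) (ih _ hY hw))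
    simpa [enc_add_single] using this

/-- The Gödel numbers of the stores from which the programs `c` can clear all counters. -/
def clearing (c : List Prog) : Set ℤ := {z | ∃ v, z = enc v ∧ EvalList c v 0}

/-- The intended solution of the constraints. -/
def solution (q : State) : Set ℤ := {u | q.2.1 + q.2.2 * u ∈ clearing q.1}

theorem mem_solution_run {c : List Prog} {z : ℤ} : z ∈ solution (run c) ↔ z ∈ clearing c := by
  simp [solution]

theorem enc_mem_clearing {c : List Prog} {v : Store} :
    (enc v : ℤ) ∈ clearing c ↔ EvalList c v 0 :=
  ⟨fun ⟨w, h, hw⟩ => by rwa [enc_injective (Nat.cast_injective h)], fun h => ⟨v, rfl, h⟩⟩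

theorem pr_mul_mem_clearing {c : List Prog} {i : ℕ} {z : ℤ} :
    pr i * z ∈ clearing c ↔ ∃ v, z = enc v ∧ EvalList c (v + single i 1) 0 := by
  constructor
  · rintro ⟨w, h, hw⟩
    obtain ⟨v, rfl, rfl⟩ := exists_of_pr_mul_eq h
    exact ⟨v, rfl, hw⟩
  · rintro ⟨v, rfl, hw⟩
    exact ⟨_, by rw [enc_add_single, Nat.cast_mul], hw⟩

theorem sat_solution (P : Prog) : ∀ c, PullRule.Sat (rules P c) solution := by
  induction P with
  | skip =>
    rintro c _ rfl u
    simp [mem_solution_run, clearing, EvalList, eval_skip]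
  | inc i =>
    rintro c _ rfl u
    simp only [mem_solution_run, zero_add, pr_mul_mem_clearing]
    simp [clearing, EvalList, eval_inc]
  | seq a b iha ihb =>
    rintro c ρ ((rfl | h) | h)
    · intro u
      simp only [mem_solution_run, zero_add, one_mul]
      refine exists_congr fun v => and_congr_right fun _ => ?_
      simp only [EvalList, eval_seq]
      tauto
    · exact iha _ _ h
    · exact ihb _ _ h
  | loop i b ih =>
    rintro c ρ (((rfl | ⟨r, -, rfl⟩) | ⟨r, hr, rfl⟩) | h)
    · intro u
      simp only [mem_solution_run, zero_add, pr_mul_mem_clearing]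
      refine exists_congr fun v => and_congr_right fun _ => ?_
      simp only [EvalList, eval_loop_add]
      tauto
    · intro u
      simp [solution]
    · intro u
      simp only [mem_solution_run]
      refine exists_congr fun v => and_congr_right fun hv => ?_
      have hi : v i = 0 := by
        by_contra hi
        have h : (pr i : ℤ) ∣ r := by
          rw [← Int.dvd_add_left (Dvd.intro u rfl), hv]
          exact_mod_cast pr_dvd_enc.2 hi
        exact Nat.not_dvd_of_pos_of_lt hr.1 hr.2 (by exact_mod_cast h)
      simp [EvalList, eval_loop_of_eq_zero hi]
    · exact ih _ _ h

theorem forced_enc_iff {P : Prog} {v : Store} :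
    PullRule.Forced (rules P []) (run []) (run [P]) (enc v) ↔ Eval P v 0 := by
  constructor
  · intro h
    have := h _ (sat_solution P []) (mem_solution_run.2 ⟨0, by simp [enc_zero], rfl⟩)
    obtain ⟨_, h, rfl⟩ := enc_mem_clearing.1 (mem_solution_run.1 this)
    exact h
  · intro h Y hY h₁
    exact enc_mem_of_eval h [] hY (by simpa [enc_zero] using h₁)

/-- Some finite system of constraints forces an undecidable set of natural numbers. -/
theorem exists_undecidable_forced : ∃ (R : Set (PullRule State)) (q₁ q₀ : State), R.Finite ∧
    (∀ ρ ∈ R, ρ.factor ≠ 0) ∧ ¬ ComputablePred fun n : ℕ => PullRule.Forced R q₁ q₀ n := by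
  obtain ⟨P, hP⟩ := exists_undecidable_prog
  refine ⟨rules P [], run [], run [P], finite_rules P [], factor_ne_zero_of_mem_rules P [],
    fun h => hP ?_⟩
  have hpow : Computable fun n : ℕ => 2 ^ n := by
    have := (Primrec.nat_rec₁ (f := fun _ ih => 2 * ih) 1
      (Primrec.nat_mul.comp (Primrec.const 2) Primrec.snd)).to_comp
    refine this.of_eq fun n => ?_
    induction n with
    | zero => rfl
    | succ n ih => simp only [pow_succ'] at ih ⊢; rw [← ih]
  obtain ⟨_, h⟩ := h
  refine ⟨fun n => decidable_of_iff _ (forced_enc_iff (v := single 0 n)),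
    (h.comp hpow).of_eq fun n => ?_⟩
  simp only [← forced_enc_iff, enc_single]

end CounterProgram
/-! ### A finitely related group encoding a pull-back system -/

namespace PullRule

open scoped commutatorElement

/-- The generators of the group of a pull-back system. -/
inductive Gen (State : Type)
  | x
  | t
  | s
  | k (q : State)
  | e (ρ : PullRule State)

variable {State : Type} {G H : Type*} [Group G] [Group H]

/-- The conjugate of the generator `t` by the power `z` of `x`. -/
def conjT (g : Gen State → G) (z : ℤ) : G := g .x ^ z * g .t * (g .x ^ z)⁻¹

/-- Conjugation by the generator `s`. -/
def conjS (g : Gen State → G) (a : G) : G := g .s * a * (g .s)⁻¹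

/-- The factor by which the stable letter of the rule `ρ` fails to identify its two states. -/
def defect (g : Gen State → G) (ρ : PullRule State) : G :=
  (conjS g (g (.k ρ.tgt)))⁻¹ * (g (.e ρ) * g (.k ρ.src) * (g (.e ρ))⁻¹)

/-- The relators contributed by the rule `ρ`. -/
def ruleRelators (g : Gen State → G) (ρ : PullRule State) : Set G :=
  {⁅g (.e ρ), g .x ^ ρ.factor * conjS g (g .x)⁆,
    g (.e ρ) * conjT g ρ.offset * (g (.e ρ))⁻¹ * (conjS g (g .t))⁻¹,
    ⁅defect g ρ, conjS g (g .x)⁆, ⁅defect g ρ, conjS g (g .t)⁆}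

/-- The relators of the group of a pull-back system. -/
def relators (R : Set (PullRule State)) (q₁ : State) (g : Gen State → G) : Set G :=
  {⁅g .x, conjS g (g .x)⁆, ⁅g .x, conjS g (g .t)⁆, ⁅g .t, conjS g (g .x)⁆,
    ⁅g (.k q₁), conjT g 1⁆} ∪ ⋃ ρ ∈ R, ruleRelators g ρ

/-- The relations of the group of a pull-back system hold for the family `g`. -/
structure Compatible (R : Set (PullRule State)) (q₁ : State) (g : Gen State → G) : Prop where
  x_x : Commute (g .x) (conjS g (g .x))
  x_t : Commute (g .x) (conjS g (g .t))
  t_x : Commute (g .t) (conjS g (g .x))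
  k_t : Commute (g (.k q₁)) (conjT g 1)
  e_x : ∀ ρ ∈ R, Commute (g (.e ρ)) (g .x ^ ρ.factor * conjS g (g .x))
  e_t : ∀ ρ ∈ R, g (.e ρ) * conjT g ρ.offset * (g (.e ρ))⁻¹ = conjS g (g .t)
  defect_x : ∀ ρ ∈ R, Commute (defect g ρ) (conjS g (g .x))
  defect_t : ∀ ρ ∈ R, Commute (defect g ρ) (conjS g (g .t))

theorem finite_relators {R : Set (PullRule State)} (hR : R.Finite) (q₁ : State)
    (g : Gen State → G) : (relators R q₁ g).Finite := by
  refine Set.Finite.union (by simp) (hR.biUnion fun ρ _ => by simp [ruleRelators])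

theorem forall_relators_eq_one_iff {R : Set (PullRule State)} {q₁ : State} {g : Gen State → G} :
    (∀ r ∈ relators R q₁ g, r = 1) ↔ Compatible R q₁ g := by
  constructor
  · intro h
    simp only [relators, ruleRelators, Set.mem_union, Set.mem_insert_iff, Set.mem_singleton_iff,
      Set.mem_iUnion, exists_prop] at h
    refine ⟨?_, ?_, ?_, ?_, fun ρ hρ => ?_, fun ρ hρ => ?_, fun ρ hρ => ?_, fun ρ hρ => ?_⟩
    · exact commutatorElement_eq_one_iff_commute.1 (h _ (by simp))
    · exact commutatorElement_eq_one_iff_commute.1 (h _ (by simp))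
    · exact commutatorElement_eq_one_iff_commute.1 (h _ (by simp))
    · exact commutatorElement_eq_one_iff_commute.1 (h _ (by simp))
    · exact commutatorElement_eq_one_iff_commute.1 (h _ (.inr ⟨ρ, hρ, by simp⟩))
    · exact mul_inv_eq_one.1 (h _ (.inr ⟨ρ, hρ, by simp⟩))
    · exact commutatorElement_eq_one_iff_commute.1 (h _ (.inr ⟨ρ, hρ, by simp⟩))
    · exact commutatorElement_eq_one_iff_commute.1 (h _ (.inr ⟨ρ, hρ, by simp⟩))
  · rintro h r ((rfl | rfl | rfl | rfl) | hr)
    · exact commutatorElement_eq_one_iff_commute.2 h.x_x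
    · exact commutatorElement_eq_one_iff_commute.2 h.x_t
    · exact commutatorElement_eq_one_iff_commute.2 h.t_x
    · exact commutatorElement_eq_one_iff_commute.2 h.k_t
    · obtain ⟨ρ, hρ, hr⟩ := Set.mem_iUnion₂.1 hr
      rcases hr with rfl | rfl | rfl | rfl
      · exact commutatorElement_eq_one_iff_commute.2 (h.e_x ρ hρ)
      · exact mul_inv_eq_one.2 (h.e_t ρ hρ)
      · exact commutatorElement_eq_one_iff_commute.2 (h.defect_x ρ hρ)
      · exact commutatorElement_eq_one_iff_commute.2 (h.defect_t ρ hρ)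

theorem relators_comp (R : Set (PullRule State)) (q₁ : State) (f : G →* H) (g : Gen State → G) :
    relators R q₁ (f ∘ g) = f '' relators R q₁ g := by
  simp [relators, ruleRelators, Set.image_union, Set.image_iUnion, Set.image_insert_eq, conjS,
    conjT, defect, map_commutatorElement]

theorem compatible_of_commGroup {A : Type*} [CommGroup A] (R : Set (PullRule State)) (q₁ : State)
    (g : Gen State → A) : Compatible R q₁ g where
  x_x := .all _ _
  x_t := .all _ _
  t_x := .all _ _
  k_t := .all _ _
  e_x _ _ := .all _ _
  e_t _ _ := by simp [conjT, conjS]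
  defect_x _ _ := .all _ _
  defect_t _ _ := .all _ _

/-- The group of a pull-back system. -/
abbrev RuleGroup (R : Set (PullRule State)) (q₁ : State) : Type :=
  PresentedGroup (relators R q₁ FreeGroup.of)

theorem compatible_of (R : Set (PullRule State)) (q₁ : State) :
    Compatible R q₁ (PresentedGroup.of : Gen State → RuleGroup R q₁) := by
  rw [← forall_relators_eq_one_iff]
  intro r hr
  have : (PresentedGroup.of : Gen State → RuleGroup R q₁) =
    PresentedGroup.mk (relators R q₁ FreeGroup.of) ∘ FreeGroup.of := rfl
  rw [this, relators_comp] at hr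
  obtain ⟨w, hw, rfl⟩ := hr
  exact PresentedGroup.one_of_mem hw

theorem Compatible.lift_eq_one {R : Set (PullRule State)} {q₁ : State} {g : Gen State → G}
    (h : Compatible R q₁ g) : ∀ r ∈ relators R q₁ FreeGroup.of, FreeGroup.lift g r = 1 := by
  intro r hr
  refine forall_relators_eq_one_iff.2 h _ ?_
  have : FreeGroup.lift g ∘ FreeGroup.of = g := by funext; simp
  have h' := relators_comp R q₁ (FreeGroup.lift g) FreeGroup.of
  rw [this] at h'
  rw [h']
  exact ⟨r, hr, rfl⟩

/-- The homomorphism defined by a compatible family. -/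
def Compatible.toHom {R : Set (PullRule State)} {q₁ : State} {g : Gen State → G}
    (h : Compatible R q₁ g) : RuleGroup R q₁ →* G := PresentedGroup.toGroup h.lift_eq_one

theorem Compatible.toHom_of {R : Set (PullRule State)} {q₁ : State} {g : Gen State → G}
    (h : Compatible R q₁ g) (a : Gen State) : h.toHom (PresentedGroup.of a) = g a :=
  PresentedGroup.toGroup.of _

theorem map_conjT (f : G →* H) (g : Gen State → G) (z : ℤ) :
    f (conjT g z) = conjT (f ∘ g) z := by
  simp [conjT]

theorem Compatible.sat {R : Set (PullRule State)} {q₁ : State} {g : Gen State → G}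
    (h : Compatible R q₁ g) : Sat R fun q => {z | Commute (g (.k q)) (conjT g z)} := by
  intro ρ hρ u
  set C := g .x ^ ρ.factor * conjS g (g .x) with hC
  have hCu : C ^ u = g .x ^ (ρ.factor * u) * conjS g (g .x) ^ u := by
    rw [hC, (h.x_x.zpow_left _).mul_zpow, zpow_mul]
  have hCu' : C ^ u = conjS g (g .x) ^ u * g .x ^ (ρ.factor * u) := by
    rw [hCu, ((h.x_x.zpow_left _).zpow_right _).eq]
  have hx1 : Commute (conjS g (g .x) ^ u) (conjT g ρ.offset) := by
    refine Commute.zpow_left ?_ _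
    exact ((h.x_x.symm.zpow_right _).mul_right h.t_x.symm).mul_right
      (h.x_x.symm.zpow_right _).inv_right
  have h₁ : conjT g (ρ.offset + ρ.factor * u) = C ^ u * conjT g ρ.offset * (C ^ u)⁻¹ := by
    rw [hCu, mul_inv_rev]
    calc _ = g .x ^ (ρ.factor * u) * conjT g ρ.offset * (g .x ^ (ρ.factor * u))⁻¹ := by
          rw [add_comm, conjT, conjT, zpow_add]; group
      _ = g .x ^ (ρ.factor * u) * (conjS g (g .x) ^ u * conjT g ρ.offset *
          (conjS g (g .x) ^ u)⁻¹) * (g .x ^ (ρ.factor * u))⁻¹ := by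
          rw [hx1.eq, mul_inv_cancel_right]
      _ = _ := by group
  have h₂ : conjS g (conjT g u) = C ^ u * conjS g (g .t) * (C ^ u)⁻¹ := by
    rw [hCu', mul_inv_rev]
    calc _ = conjS g (g .x) ^ u * conjS g (g .t) * (conjS g (g .x) ^ u)⁻¹ := by
          simp only [conjS, conjT, conj_zpow]; group
      _ = conjS g (g .x) ^ u * (g .x ^ (ρ.factor * u) * conjS g (g .t) *
          (g .x ^ (ρ.factor * u))⁻¹) * (conjS g (g .x) ^ u)⁻¹ := by
          rw [(h.x_t.zpow_left _).eq, mul_inv_cancel_right]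
      _ = _ := by group
  have h₃ : g (.e ρ) * conjT g (ρ.offset + ρ.factor * u) * (g (.e ρ))⁻¹ =
      conjS g (conjT g u) := by
    have hE : Commute (g (.e ρ)) (C ^ u) := (h.e_x ρ hρ).zpow_right u
    rw [h₁, h₂, ← h.e_t ρ hρ]
    calc _ = (g (.e ρ) * C ^ u) * conjT g ρ.offset * (g (.e ρ) * C ^ u)⁻¹ := by group
      _ = _ := by rw [hE.eq]; group
  have h₄ : Commute (defect g ρ) (conjS g (conjT g u)) := by
    have : conjS g (conjT g u) =
        conjS g (g .x) ^ u * conjS g (g .t) * (conjS g (g .x) ^ u)⁻¹ := by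
      simp only [conjS, conjT, conj_zpow]; group
    rw [this]
    exact (((h.defect_x ρ hρ).zpow_right u).mul_right (h.defect_t ρ hρ)).mul_right
      ((h.defect_x ρ hρ).zpow_right u).inv_right
  have h₅ : g (.e ρ) * g (.k ρ.src) * (g (.e ρ))⁻¹ = conjS g (g (.k ρ.tgt)) * defect g ρ := by
    rw [defect, mul_inv_cancel_left]
  have h₆ : ∀ a b c : G, Commute (c * a * c⁻¹) (c * b * c⁻¹) ↔ Commute a b := fun a b c =>
    Commute.conj_iff c
  change Commute _ _ ↔ Commute _ _
  rw [← h₆ (g (.k ρ.src)) _ (g (.e ρ)), h₃, h₅, ← h₆ _ _ (g .s)]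
  change Commute (conjS g _) (conjS g _) ↔ _
  constructor
  · intro hc
    exact Commute.mul_left hc h₄
  · intro hc
    have := hc.mul_left h₄.inv_left
    rwa [mul_inv_cancel_right] at this

/-! #### A permutation model -/

/-- Two copies of the integers. -/
abbrev Line := ℤ ⊕ ℤ

/-- The permutation acting by `f a` on the fibre over `a`. -/
def fibrewise : (Line → Equiv.Perm (Fin 3)) →* Equiv.Perm (Line × Fin 3) where
  toFun f := Equiv.prodShear (Equiv.refl _) f
  map_one' := by ext ⟨a, i⟩ <;> simp
  map_mul' f g := by ext ⟨a, i⟩ <;> simp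

/-- The permutation acting on the base. -/
def base : Equiv.Perm Line →* Equiv.Perm (Line × Fin 3) where
  toFun f := Equiv.prodCongr f (Equiv.refl _)
  map_one' := by ext ⟨a, i⟩ <;> simp
  map_mul' f g := by ext ⟨a, i⟩ <;> simp

theorem fibrewise_injective : Function.Injective fibrewise := by
  intro f g h
  funext a
  ext i
  have := congrArg Prod.snd (Equiv.congr_fun h (a, i))
  exact congrArg Fin.val this

theorem base_conj (π : Equiv.Perm Line) (f : Line → Equiv.Perm (Fin 3)) :
    base π * fibrewise f * (base π)⁻¹ = fibrewise (f ∘ π.symm) := by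
  rw [mul_inv_eq_iff_eq_mul]
  ext ⟨a, i⟩ <;> simp [base, fibrewise]

theorem base_conj_single (π : Equiv.Perm Line) (a : Line) (σ : Equiv.Perm (Fin 3)) :
    base π * fibrewise (Pi.mulSingle a σ) * (base π)⁻¹ = fibrewise (Pi.mulSingle (π a) σ) := by
  rw [base_conj]
  congr 1
  funext b
  simp [Pi.mulSingle_apply, Equiv.symm_apply_eq]

/-- The translation of the first copy of the integers. -/
def shift : Equiv.Perm Line := Equiv.sumCongr (Equiv.addRight 1) (Equiv.refl _)

theorem shift_zpow_inl (z a : ℤ) : (shift ^ z) (Sum.inl a) = Sum.inl (a + z) := by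
  have h : ∀ a, shift (Sum.inl a) = Sum.inl (a + 1) := fun a => rfl
  induction z generalizing a with
  | zero => simp
  | succ n ih => rw [zpow_add_one, Equiv.Perm.mul_apply, h, ih]; congr 1; ring
  | pred n ih =>
    have h' : shift⁻¹ (Sum.inl a) = Sum.inl (a - 1) := by
      rw [Equiv.Perm.inv_eq_iff_eq, h]; simp
    rw [zpow_sub_one, Equiv.Perm.mul_apply, h', ih]; congr 1; ring

theorem shift_zpow_inr (z a : ℤ) : (shift ^ z) (Sum.inr a) = Sum.inr a := by
  have h : ∀ a, shift (Sum.inr a) = Sum.inr a := fun a => rfl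
  exact Equiv.Perm.zpow_apply_eq_self_of_apply_eq_self (h a) z

/-- The involution exchanging `u` in the second copy of the integers with `r + m * u` in the
first. -/
def exchangeFun (r m : ℤ) : Line → Line
  | .inl a => if m ∣ a - r then .inr ((a - r) / m) else .inl a
  | .inr u => .inl (r + m * u)

theorem exchangeFun_involutive (r : ℤ) {m : ℤ} (hm : m ≠ 0) :
    Function.Involutive (exchangeFun r m) := by
  rintro (a | u)
  · by_cases h : m ∣ a - r
    · obtain ⟨u, hu⟩ := h
      obtain rfl : a = r + m * u := by linarith
      simp [exchangeFun, hm]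
    · simp [exchangeFun, h]
  · simp [exchangeFun, hm]

/-- The permutation model of the group of a pull-back system given by a solution `Y`. -/
noncomputable def model (σ τ : Equiv.Perm (Fin 3)) (Y : State → Set ℤ) :
    Gen State → Equiv.Perm (Line × Fin 3)
  | .x => base shift
  | .t => fibrewise (Pi.mulSingle (.inl 0) σ)
  | .s => base (Equiv.sumComm ℤ ℤ)
  | .k q => open Classical in fibrewise (Sum.elim (fun z => if z ∈ Y q then 1 else τ) fun _ => 1)
  | .e ρ => open Classical in
    if hm : ρ.factor ≠ 0 then base (exchangeFun_involutive ρ.offset hm).toPerm else 1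

variable {σ τ : Equiv.Perm (Fin 3)} {Y : State → Set ℤ}

theorem conjT_model (z : ℤ) :
    conjT (model σ τ Y) z = fibrewise (Pi.mulSingle (.inl z) σ) := by
  simp only [conjT, model]
  rw [← map_zpow, base_conj_single, shift_zpow_inl, zero_add]

theorem conjS_model_t :
    conjS (model σ τ Y) (model σ τ Y .t) = fibrewise (Pi.mulSingle (.inr 0) σ) := by
  simp only [conjS, model]
  rw [base_conj_single]
  rfl

theorem conjS_model_x : conjS (model σ τ Y) (model σ τ Y .x) =
    base (Equiv.sumCongr (Equiv.refl _) (Equiv.addRight 1)) := by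
  simp only [conjS, model]
  rw [← map_inv, ← map_mul, ← map_mul]
  congr 1
  ext (a | a) <;> rfl

theorem commute_base_fibrewise {π : Equiv.Perm Line} {f : Line → Equiv.Perm (Fin 3)}
    (h : ∀ a, f (π a) = f a) : Commute (base π) (fibrewise f) := by
  rw [commute_iff_eq, ← mul_inv_eq_iff_eq_mul, base_conj]
  congr 1
  funext a
  rw [Function.comp_apply, ← h, Equiv.apply_symm_apply]

theorem compatible_model {R : Set (PullRule State)} {q₁ : State}
    (hm : ∀ ρ ∈ R, ρ.factor ≠ 0) (hY : Sat R Y) (h₁ : 1 ∈ Y q₁) :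
    Compatible R q₁ (model σ τ Y) := by
  have hdef : ∀ ρ ∈ R, ∃ f : ℤ → Equiv.Perm (Fin 3),
      defect (model σ τ Y) ρ = fibrewise (Sum.elim f fun _ => 1) := by
    intro ρ hρ
    refine ⟨fun a => (Sum.elim (fun z => open Classical in if z ∈ Y ρ.src then 1 else τ)
        (fun _ => 1) : Line → Equiv.Perm (Fin 3)) (exchangeFun ρ.offset ρ.factor (.inl a)), ?_⟩
    · simp only [defect, conjS, model, dif_pos (hm ρ hρ)]
      rw [base_conj, base_conj, ← map_inv, ← map_mul]
      congr 1
      funext a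
      rcases a with a | u
      · simp [Function.Involutive.toPerm]
      · have := hY ρ hρ u
        by_cases hu : u ∈ Y ρ.tgt
        · simp [Function.Involutive.toPerm, exchangeFun, hu, this.1 hu]
        · simp [Function.Involutive.toPerm, exchangeFun, hu, mt this.2 hu]
  constructor
  · rw [conjS_model_x]
    refine Commute.map ?_ base
    ext (a | a) <;> rfl
  · rw [conjS_model_t]
    refine commute_base_fibrewise ?_
    rintro (a | a) <;> simp [shift, Pi.mulSingle_apply]
  · rw [conjS_model_x]
    refine (commute_base_fibrewise ?_).symm
    rintro (a | a) <;> simp [Pi.mulSingle_apply]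
  · rw [conjT_model]
    refine Commute.map ?_ fibrewise
    rw [commute_iff_eq]
    funext a
    by_cases ha : a = .inl 1
    · subst ha; simp [h₁]
    · simp [Pi.mulSingle_eq_of_ne ha]
  · intro ρ hρ
    rw [conjS_model_x]
    simp only [model, dif_pos (hm ρ hρ)]
    rw [← map_zpow, ← map_mul]
    refine Commute.map ?_ base
    ext1 a
    rcases a with a | u
    · by_cases h : ρ.factor ∣ a - ρ.offset
      · obtain ⟨u, hu⟩ := h
        obtain rfl : a = ρ.offset + ρ.factor * u := by linarith
        have : ρ.offset + ρ.factor * u + ρ.factor - ρ.offset = ρ.factor * (u + 1) := by ring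
        simp [exchangeFun, shift_zpow_inl, shift_zpow_inr, hm ρ hρ, this]
      · have : ¬ ρ.factor ∣ a + ρ.factor - ρ.offset := by
          rwa [add_sub_right_comm, dvd_add_self_right]
        simp [exchangeFun, shift_zpow_inl, h, this]
    · simp [exchangeFun, shift_zpow_inl, shift_zpow_inr]; ring
  · intro ρ hρ
    rw [conjT_model, conjS_model_t]
    simp only [model, dif_pos (hm ρ hρ)]
    rw [base_conj_single]
    simp [exchangeFun]
  · intro ρ hρ
    obtain ⟨f, hf⟩ := hdef ρ hρ
    rw [hf, conjS_model_x]
    refine (commute_base_fibrewise ?_).symm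
    rintro (a | a) <;> simp
  · intro ρ hρ
    obtain ⟨f, hf⟩ := hdef ρ hρ
    rw [hf, conjS_model_t]
    refine Commute.map ?_ fibrewise
    rw [commute_iff_eq]
    funext a
    rcases a with a | a <;> simp

/-- In the group of a pull-back system, commutation detects the forced integers. -/
theorem commute_iff_forced {R : Set (PullRule State)} {q₁ : State} (hm : ∀ ρ ∈ R, ρ.factor ≠ 0)
    (q₀ : State) (z : ℤ) :
    Commute (PresentedGroup.of (.k q₀) : RuleGroup R q₁) (conjT PresentedGroup.of z) ↔
      Forced R q₁ q₀ z := by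
  constructor
  · intro h Y hY h₁
    by_contra hz
    let σ : Equiv.Perm (Fin 3) := Equiv.swap 0 1
    let τ : Equiv.Perm (Fin 3) := Equiv.swap 1 2
    have hmod := compatible_model (σ := σ) (τ := τ) hm hY h₁
    have hc := h.map hmod.toHom
    rw [map_conjT, hmod.toHom_of, show hmod.toHom ∘ PresentedGroup.of = model σ τ Y from
      funext hmod.toHom_of, conjT_model] at hc
    simp only [model, commute_iff_eq, ← map_mul] at hc
    have := congrFun (fibrewise_injective hc) (.inl z)
    simp only [Pi.mul_apply, Sum.elim_inl, if_neg hz, Pi.mulSingle_eq_same] at this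
    exact absurd this (by decide)
  · intro h
    exact h _ (compatible_of R q₁).sat (compatible_of R q₁).k_t

end PullRule
/-! ### The pree of a partial Latin square -/

namespace LatinPree

/-- The associative law for a relation `R a b c`, to be read as `a b = c`, all of whose nontrivial
elements are arrows of a groupoid with three objects and no nontrivial endomorphisms. -/
theorem rel_assoc {α : Type*} {R : α → α → α → Prop} {one : α} {inv : α → α} {src tgt : α → Fin 3}
    (hfun : ∀ {a b c c'}, R a b c → R a b c' → c = c')
    (hone_mul : ∀ a, R one a a) (hmul_one : ∀ a, R a one a)
    (hleft : ∀ {a b c}, R a b c → R (inv a) c b) (hright : ∀ {a b c}, R a b c → R c (inv b) a)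
    (hmul_inv : ∀ a, R a (inv a) one)
    (hinv : ∀ {a b}, R a b one → b = inv a) (hinv_inv : ∀ a, inv (inv a) = a)
    (hloop : ∀ a, a ≠ one → src a ≠ tgt a)
    (hcomp : ∀ {a b c}, R a b c → a ≠ one → b ≠ one → c ≠ one →
      tgt a = src b ∧ src c = src a ∧ tgt c = tgt b)
    {a b d x y z : α} (hx : R a b x) (hy : R b d y) (hz : R x d z) : R a y z := by
  by_cases ha : a = one
  · subst ha
    obtain rfl := hfun hx (hone_mul b)
    obtain rfl := hfun hy hz
    exact hone_mul _
  by_cases hb : b = one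
  · subst hb
    obtain rfl := hfun hx (hmul_one a)
    obtain rfl := hfun hy (hone_mul d)
    exact hz
  by_cases hd : d = one
  · subst hd
    obtain rfl := hfun hy (hmul_one b)
    obtain rfl := hfun hz (hmul_one x)
    exact hx
  by_cases hx1 : x = one
  · subst hx1
    obtain rfl := hfun hz (hone_mul d)
    obtain rfl := hinv hx
    have := hleft hy
    rwa [hinv_inv] at this
  by_cases hy1 : y = one
  · subst hy1
    obtain rfl := hinv hy
    obtain rfl := hfun hz (hright hx)
    exact hmul_one _
  have h₁ := hcomp hx ha hb hx1
  have h₂ := hcomp hy hb hd hy1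
  have hz1 : z = one := by
    by_contra hz1
    have h₃ := hcomp hz hx1 hd hz1
    have := hloop _ ha
    have := hloop _ hb
    have := hloop _ hd
    have := hloop _ hx1
    have := hloop _ hy1
    have := hloop _ hz1
    omega
  subst hz1
  obtain rfl := hinv hz
  obtain rfl : y = inv a := hfun hy (by
    have := hright (hleft hx)
    exact this)
  exact hmul_inv a

/-- The elements of the pree of a partial Latin square: an identity and, for every index, a row,
a column, a symbol and their inverses. -/
inductive El
  | one
  | row (i : ℕ)
  | row' (i : ℕ)
  | col (i : ℕ)
  | col' (i : ℕ)
  | sym (i : ℕ)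
  | sym' (i : ℕ)

namespace El

/-- The inverse function. -/
def inv : El → El
  | one => one
  | row i => row' i
  | row' i => row i
  | col i => col' i
  | col' i => col i
  | sym i => sym' i
  | sym' i => sym i

/-- The index of an element. -/
def idx : El → ℕ
  | one => 0
  | row i | row' i | col i | col' i | sym i | sym' i => i

/-- The source object. -/
def src : El → Fin 3
  | one | row _ | sym _ => 0
  | row' _ | col _ => 1
  | col' _ | sym' _ => 2

/-- The numbering of the elements. -/
def code : El → ℕ
  | one => 0
  | row i => 6 * i + 1
  | row' i => 6 * i + 2
  | col i => 6 * i + 3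
  | col' i => 6 * i + 4
  | sym i => 6 * i + 5
  | sym' i => 6 * i + 6

theorem inv_inv (a : El) : a.inv.inv = a := by cases a <;> rfl

theorem code_injective : Function.Injective code := by
  rintro ⟨⟩ ⟨⟩ h <;> simp only [code] at h <;> first | rfl | (exfalso; omega) | (congr 1; omega)

theorem code_surjective : Function.Surjective code := by
  intro n
  obtain rfl | ⟨m, rfl⟩ : n = 0 ∨ ∃ m, n = m + 1 := by cases n <;> simp
  · exact ⟨one, rfl⟩
  have := Nat.mod_lt m (show 6 > 0 by norm_num)
  obtain h | h | h | h | h | h : m % 6 = 0 ∨ m % 6 = 1 ∨ m % 6 = 2 ∨ m % 6 = 3 ∨ m % 6 = 4 ∨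
    m % 6 = 5 := by omega
  exacts [⟨row (m / 6), by simp only [code]; omega⟩, ⟨row' (m / 6), by simp only [code]; omega⟩,
    ⟨col (m / 6), by simp only [code]; omega⟩, ⟨col' (m / 6), by simp only [code]; omega⟩,
    ⟨sym (m / 6), by simp only [code]; omega⟩, ⟨sym' (m / 6), by simp only [code]; omega⟩]

theorem code_lt_iff {a : El} {N : ℕ} (hN : 0 < N) : a.code < 6 * N + 1 ↔ a.idx < N := by
  cases a <;> simp only [code, idx] <;> omega

end El

/-- Any two entries of a triple in `T` determine the third one. -/
structure IsLatin (T : Set (ℕ × ℕ × ℕ)) : Prop where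
  sym_eq : ∀ {a b c c'}, (a, b, c) ∈ T → (a, b, c') ∈ T → c = c'
  col_eq : ∀ {a b b' c}, (a, b, c) ∈ T → (a, b', c) ∈ T → b = b'
  row_eq : ∀ {a a' b c}, (a, b, c) ∈ T → (a', b, c) ∈ T → a = a'

open El

/-- The multiplication of the pree of a partial Latin square. -/
inductive Rel (T : Set (ℕ × ℕ × ℕ)) : El → El → El → Prop
  | one_mul (a) : Rel T one a a
  | mul_one (a) : Rel T a one a
  | mul_inv {a b} (h : b = a.inv) : Rel T a b one
  | row_col {i j k} (h : (i, j, k) ∈ T) : Rel T (row i) (col j) (sym k)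
  | sym_col' {i j k} (h : (i, j, k) ∈ T) : Rel T (sym k) (col' j) (row i)
  | row'_sym {i j k} (h : (i, j, k) ∈ T) : Rel T (row' i) (sym k) (col j)
  | col'_row' {i j k} (h : (i, j, k) ∈ T) : Rel T (col' j) (row' i) (sym' k)
  | col_sym' {i j k} (h : (i, j, k) ∈ T) : Rel T (col j) (sym' k) (row' i)
  | sym'_row {i j k} (h : (i, j, k) ∈ T) : Rel T (sym' k) (row i) (col' j)

namespace Rel

variable {T : Set (ℕ × ℕ × ℕ)} {a b c d x y z : El}

theorem unique (hT : IsLatin T) {c' : El} (h : Rel T a b c) (h' : Rel T a b c') : c = c' := by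
  cases h <;> cases h' <;> first
    | rfl
    | (rename_i h; exact h)
    | (rename_i h; exact h.symm)
    | (rename_i h; cases h)
    | (rename_i h; cases a <;> first | rfl | cases h)
    | (rename_i h _ h'; exact congrArg _ (hT.sym_eq h h'))
    | (rename_i h _ h'; exact congrArg _ (hT.col_eq h h'))
    | (rename_i h _ h'; exact congrArg _ (hT.row_eq h h'))

theorem left (h : Rel T a b c) : Rel T a.inv c b := by
  cases h with
  | one_mul => exact .one_mul _
  | mul_one => exact .mul_inv (El.inv_inv a).symm
  | mul_inv h => subst h; exact .mul_one _
  | row_col h => exact .row'_sym h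
  | sym_col' h => exact .sym'_row h
  | row'_sym h => exact .row_col h
  | col'_row' h => exact .col_sym' h
  | col_sym' h => exact .col'_row' h
  | sym'_row h => exact .sym_col' h

theorem right (h : Rel T a b c) : Rel T c b.inv a := by
  cases h with
  | one_mul => exact .mul_inv rfl
  | mul_one => exact .mul_one _
  | mul_inv h => subst h; rw [El.inv_inv]; exact .one_mul _
  | row_col h => exact .sym_col' h
  | sym_col' h => exact .row_col h
  | row'_sym h => exact .col_sym' h
  | col'_row' h => exact .sym'_row h
  | col_sym' h => exact .row'_sym h
  | sym'_row h => exact .col'_row' h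

theorem anti (h : Rel T a b c) : Rel T b.inv a.inv c.inv := h.left.right.left

theorem eq_inv (h : Rel T a b one) : b = a.inv := by
  cases h with
  | one_mul => rfl
  | mul_one => rfl
  | mul_inv h => exact h

theorem assoc (hT : IsLatin T) (hx : Rel T a b x) (hy : Rel T b d y) (hz : Rel T x d z) :
    Rel T a y z := by
  refine rel_assoc (R := Rel T) (one := one) (inv := El.inv) (src := src)
    (tgt := fun a => src a.inv) (Rel.unique hT) .one_mul .mul_one Rel.left Rel.right
    (fun _ => .mul_inv rfl) Rel.eq_inv El.inv_inv ?_ ?_ hx hy hz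
  · rintro (_ | _) ha <;> first | exact absurd rfl ha | simp [src, El.inv]
  · intro a b c h ha hb hc
    cases h <;> first | contradiction | simp [src, El.inv]

theorem assoc' (hT : IsLatin T) (hx : Rel T a b x) (hy : Rel T b d y) (hz : Rel T a y z) :
    Rel T x d z := by
  have := (assoc hT hy.anti hx.anti hz.anti).anti
  simpa only [El.inv_inv] using this

end Rel

/-- The numbering of the inverse function. -/
def invCode (n : ℕ) : ℕ := if n = 0 then 0 else if n % 2 = 1 then n + 1 else n - 1

theorem invCode_code (a : El) : invCode a.code = a.inv.code := by
  unfold invCode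
  split_ifs <;> cases a <;> simp only [El.code, El.inv] at * <;> omega

/-- The graph of the multiplication, for a partial Latin square on `{0, …, N - 1}`. -/
def graph (N : ℕ) (T : List (ℕ × ℕ × ℕ)) : List ((ℕ × ℕ) × ℕ) :=
  ((List.range (6 * N + 1)).flatMap fun n => [((0, n), n), ((n, 0), n), ((n, invCode n), 0)]) ++
  T.flatMap fun τ =>
    [(((row τ.1).code, (col τ.2.1).code), (sym τ.2.2).code),
    (((sym τ.2.2).code, (col' τ.2.1).code), (row τ.1).code),
    (((row' τ.1).code, (sym τ.2.2).code), (col τ.2.1).code),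
    (((col' τ.2.1).code, (row' τ.1).code), (sym' τ.2.2).code),
    (((col τ.2.1).code, (sym' τ.2.2).code), (row' τ.1).code),
    (((sym' τ.2.2).code, (row τ.1).code), (col' τ.2.1).code)]

/-- The code of the pree of a partial Latin square on `{0, …, N - 1}`. -/
def preeCode (N : ℕ) (T : List (ℕ × ℕ × ℕ)) : PreeCode :=
  (6 * N + 1, 0, (List.range (6 * N + 1)).map invCode,
    (List.range (6 * N + 1)).map fun a => (List.range (6 * N + 1)).map fun b =>
      (graph N T).lookup (a, b))

theorem primrec_invCode : Primrec invCode := by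
  refine Primrec.ite (Primrec.eq.comp .id (.const 0)) (.const 0) ?_
  refine Primrec.ite (Primrec.eq.comp (Primrec.nat_mod.comp .id (.const 2)) (.const 1)) ?_ ?_
  · exact Primrec.succ
  · exact Primrec.nat_sub.comp .id (.const 1)

theorem primrec_graph {α : Type*} [Primcodable α] {N : α → ℕ} {T : α → List (ℕ × ℕ × ℕ)}
    (hN : Primrec N) (hT : Primrec T) : Primrec fun a => graph (N a) (T a) := by
  have hlin : ∀ (c : ℕ), Primrec fun n : ℕ => 6 * n + c := fun c =>
    Primrec.nat_add.comp (Primrec.nat_mul.comp (.const 6) .id) (.const c)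
  have hnil {β γ : Type} [Primcodable β] [Primcodable γ] : Primrec fun _ : β => ([] : List γ) :=
    .const []
  unfold graph
  simp only [El.code]
  refine Primrec.list_append.comp (Primrec.list_flatMap ?_ ?_) (Primrec.list_flatMap hT ?_)
  · exact Primrec.list_range.comp ((hlin 1).comp hN)
  · have h : Primrec fun n : ℕ => [((0, n), n), ((n, 0), n), ((n, invCode n), 0)] :=
      Primrec.list_cons.comp (.pair (.pair (.const 0) .id) .id)
        (Primrec.list_cons.comp (.pair (.pair .id (.const 0)) .id)
          (Primrec.list_cons.comp (.pair (.pair .id primrec_invCode) (.const 0)) hnil))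
    exact h.comp Primrec.snd
  · have h₁ : ∀ c, Primrec fun τ : ℕ × ℕ × ℕ => 6 * τ.1 + c := fun c => (hlin c).comp .fst
    have h₂ : ∀ c, Primrec fun τ : ℕ × ℕ × ℕ => 6 * τ.2.1 + c := fun c =>
      (hlin c).comp (Primrec.fst.comp .snd)
    have h₃ : ∀ c, Primrec fun τ : ℕ × ℕ × ℕ => 6 * τ.2.2 + c := fun c =>
      (hlin c).comp (Primrec.snd.comp .snd)
    have h : Primrec fun τ : ℕ × ℕ × ℕ =>
        [((6 * τ.1 + 1, 6 * τ.2.1 + 3), 6 * τ.2.2 + 5),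
        ((6 * τ.2.2 + 5, 6 * τ.2.1 + 4), 6 * τ.1 + 1),
        ((6 * τ.1 + 2, 6 * τ.2.2 + 5), 6 * τ.2.1 + 3),
        ((6 * τ.2.1 + 4, 6 * τ.1 + 2), 6 * τ.2.2 + 6),
        ((6 * τ.2.1 + 3, 6 * τ.2.2 + 6), 6 * τ.1 + 2),
        ((6 * τ.2.2 + 6, 6 * τ.1 + 1), 6 * τ.2.1 + 4)] :=
      Primrec.list_cons.comp (.pair (.pair (h₁ _) (h₂ _)) (h₃ _))
        (Primrec.list_cons.comp (.pair (.pair (h₃ _) (h₂ _)) (h₁ _))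
        (Primrec.list_cons.comp (.pair (.pair (h₁ _) (h₃ _)) (h₂ _))
        (Primrec.list_cons.comp (.pair (.pair (h₂ _) (h₁ _)) (h₃ _))
        (Primrec.list_cons.comp (.pair (.pair (h₂ _) (h₃ _)) (h₁ _))
        (Primrec.list_cons.comp (.pair (.pair (h₃ _) (h₁ _)) (h₂ _)) hnil)))))
    exact h.comp Primrec.snd

theorem primrec_preeCode {N : ℕ → ℕ} {T : ℕ → List (ℕ × ℕ × ℕ)}
    (hN : Primrec N) (hT : Primrec T) : Primrec fun n => preeCode (N n) (T n) := by
  have hsize : Primrec fun n => 6 * N n + 1 :=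
    Primrec.nat_add.comp (Primrec.nat_mul.comp (.const 6) hN) (.const 1)
  have hrange : Primrec fun n => List.range (6 * N n + 1) := Primrec.list_range.comp hsize
  refine .pair hsize (.pair (.const 0) (.pair ?_ ?_))
  · exact Primrec.list_map hrange (primrec_invCode.comp .snd)
  · refine Primrec.list_map hrange (Primrec.list_map (hrange.comp .fst) ?_)
    have h := Primrec.listLookup.comp (.pair (Primrec.snd.comp .fst) .snd)
      ((primrec_graph hN hT).comp (Primrec.fst.comp .fst))
    rw [lawful_beq_subsingleton instBEqOfDecidableEq (instBEqProd : BEq (ℕ × ℕ))] at h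
    exact h.to₂

variable {N : ℕ} {T : List (ℕ × ℕ × ℕ)} {a b c : El}

theorem mem_graph_iff (hN : 0 < N) (ha : a.idx < N) (hb : b.idx < N) :
    ((a.code, b.code), c.code) ∈ graph N T ↔ Rel {τ | τ ∈ T} a b c := by
  constructor
  · intro h
    rcases List.mem_append.1 h with h | h
    · obtain ⟨n, -, h⟩ := List.mem_flatMap.1 h
      obtain ⟨d, rfl⟩ := code_surjective n
      rw [invCode_code, show (0 : ℕ) = one.code from rfl] at h
      simp only [List.mem_cons, Prod.mk.injEq, code_injective.eq_iff, List.not_mem_nil,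
        or_false] at h
      rcases h with ⟨⟨rfl, rfl⟩, rfl⟩ | ⟨⟨rfl, rfl⟩, rfl⟩ | ⟨⟨rfl, rfl⟩, rfl⟩
      · exact .one_mul _
      · exact .mul_one _
      · exact .mul_inv rfl
    · obtain ⟨⟨i, j, k⟩, hτ, h⟩ := List.mem_flatMap.1 h
      simp only [List.mem_cons, Prod.mk.injEq, code_injective.eq_iff, List.not_mem_nil,
        or_false] at h
      rcases h with ⟨⟨rfl, rfl⟩, rfl⟩ | ⟨⟨rfl, rfl⟩, rfl⟩ | ⟨⟨rfl, rfl⟩, rfl⟩ | ⟨⟨rfl, rfl⟩, rfl⟩ |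
        ⟨⟨rfl, rfl⟩, rfl⟩ | ⟨⟨rfl, rfl⟩, rfl⟩
      exacts [.row_col hτ, .sym_col' hτ, .row'_sym hτ, .col'_row' hτ, .col_sym' hτ, .sym'_row hτ]
  · intro h
    have hrange : ∀ d : El, d.idx < N → d.code ∈ List.range (6 * N + 1) := fun d hd =>
      List.mem_range.2 ((code_lt_iff hN).2 hd)
    cases h with
    | one_mul =>
      exact List.mem_append_left _ (List.mem_flatMap.2 ⟨_, hrange _ hb, by simp [El.code]⟩)
    | mul_one =>
      exact List.mem_append_left _ (List.mem_flatMap.2 ⟨_, hrange _ ha, by simp [El.code]⟩)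
    | mul_inv h =>
      subst h
      refine List.mem_append_left _ (List.mem_flatMap.2 ⟨_, hrange _ ha, ?_⟩)
      rw [invCode_code]; simp [El.code]
    | row_col h | sym_col' h | row'_sym h | col'_row' h | col_sym' h | sym'_row h =>
      exact List.mem_append_right _ (List.mem_flatMap.2 ⟨_, h, by simp⟩)

theorem size_preeCode : (preeCode N T).size = 6 * N + 1 := rfl

theorem invOf_preeCode (hN : 0 < N) (ha : a.idx < N) :
    (preeCode N T).invOf a.code = a.inv.code := by
  have := (code_lt_iff hN).2 ha
  simp [PreeCode.invOf, preeCode, List.getD, this, invCode_code]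

theorem mulOf_preeCode (hT : IsLatin {τ | τ ∈ T}) (hN : 0 < N) (ha : a.idx < N) (hb : b.idx < N) :
    (preeCode N T).mulOf a.code b.code = some c.code ↔ Rel {τ | τ ∈ T} a b c := by
  have ha' := (code_lt_iff hN).2 ha
  have hb' := (code_lt_iff hN).2 hb
  have : (preeCode N T).mulOf a.code b.code = (graph N T).lookup (a.code, b.code) := by
    simp [PreeCode.mulOf, preeCode, List.getD, ha', hb']
  rw [this, ← mem_graph_iff hN ha hb]
  have hmem : ∀ d, (graph N T).lookup (a.code, b.code) = some d →
      ((a.code, b.code), d) ∈ graph N T := fun d hd => by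
    obtain ⟨l₁, l₂, h, -⟩ := List.lookup_eq_some_iff.1 hd
    simp [h]
  refine ⟨hmem _, fun h => ?_⟩
  obtain ⟨d, hd⟩ : ∃ d, (graph N T).lookup (a.code, b.code) = some d := by
    rw [← Option.isSome_iff_exists, List.lookup_isSome_iff]
    exact ⟨_, h, by simp⟩
  obtain ⟨d, rfl⟩ := code_surjective d
  rw [hd, Rel.unique hT ((mem_graph_iff hN ha hb).1 (hmem _ hd)) ((mem_graph_iff hN ha hb).1 h)]

theorem Rel.idx_lt (hN : 0 < N) (hb : ∀ τ ∈ T, τ.1 < N ∧ τ.2.1 < N ∧ τ.2.2 < N)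
    (ha' : a.idx < N) (hb' : b.idx < N) (h : Rel {τ | τ ∈ T} a b c) : c.idx < N := by
  cases h with
  | one_mul => exact hb'
  | mul_one => exact ha'
  | mul_inv => exact hN
  | row_col h | col'_row' h => exact (hb _ h).2.2
  | sym_col' h | col_sym' h => exact (hb _ h).1
  | row'_sym h | sym'_row h => exact (hb _ h).2.1

theorem idx_inv : a.inv.idx = a.idx := by cases a <;> rfl

theorem isValid_preeCode (hT : IsLatin {τ | τ ∈ T}) (hN : 0 < N)
    (hb : ∀ τ ∈ T, τ.1 < N ∧ τ.2.1 < N ∧ τ.2.2 < N) : (preeCode N T).IsValid := by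
  have hcode : ∀ n < (preeCode N T).size, ∃ a : El, a.code = n ∧ a.idx < N := fun n hn => by
    obtain ⟨a, rfl⟩ := code_surjective n
    exact ⟨a, rfl, (code_lt_iff hN).1 hn⟩
  have hone : (preeCode N T).oneOf = one.code := rfl
  have hmul : ∀ {a b : El} {d : ℕ}, a.idx < N → b.idx < N →
      (preeCode N T).mulOf a.code b.code = some d →
      ∃ c : El, c.code = d ∧ c.idx < N ∧ Rel {τ | τ ∈ T} a b c := fun {a b d} ha hb' h => by
    obtain ⟨c, rfl⟩ := code_surjective d
    have := (mulOf_preeCode hT hN ha hb').1 h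
    exact ⟨c, rfl, this.idx_lt hN hb ha hb', this⟩
  refine ⟨?_, by simp [preeCode, PreeCode.size], ?_, by simp [preeCode, PreeCode.size],
    by simp [preeCode, PreeCode.size], ?_, ?_, ?_, ?_, ?_, ?_, ?_, ?_⟩
  · simp [hone, El.code, size_preeCode]
  · intro a ha
    obtain ⟨a, rfl, ha₁⟩ := hcode a ha
    rw [invOf_preeCode hN ha₁]
    exact (code_lt_iff hN).2 (idx_inv.trans_lt ha₁)
  · intro a b d ha hq h
    obtain ⟨a, rfl, ha₁⟩ := hcode a ha
    obtain ⟨b, rfl, hq₁⟩ := hcode b hq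
    obtain ⟨c, rfl, hc₁, -⟩ := hmul ha₁ hq₁ h
    exact (code_lt_iff hN).2 hc₁
  · intro a ha
    obtain ⟨a, rfl, ha₁⟩ := hcode a ha
    rw [hone]
    exact (mulOf_preeCode (a := one) hT hN hN ha₁).2 (.one_mul _)
  · intro a ha
    obtain ⟨a, rfl, ha₁⟩ := hcode a ha
    rw [hone]
    exact (mulOf_preeCode (b := one) hT hN ha₁ hN).2 (.mul_one _)
  · intro a ha
    obtain ⟨a, rfl, ha₁⟩ := hcode a ha
    rw [invOf_preeCode hN ha₁, invOf_preeCode hN (idx_inv.trans_lt ha₁), El.inv_inv]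
  · intro a ha
    obtain ⟨a, rfl, ha₁⟩ := hcode a ha
    rw [invOf_preeCode hN ha₁, hone, mulOf_preeCode hT hN ha₁ (idx_inv.trans_lt ha₁)]
    exact .mul_inv rfl
  · intro a ha
    obtain ⟨a, rfl, ha₁⟩ := hcode a ha
    rw [invOf_preeCode hN ha₁, hone, mulOf_preeCode hT hN (idx_inv.trans_lt ha₁) ha₁]
    exact .mul_inv (El.inv_inv a).symm
  · intro a b d x y ha hq hd hx hy
    obtain ⟨a, rfl, ha₁⟩ := hcode a ha
    obtain ⟨b, rfl, hq₁⟩ := hcode b hq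
    obtain ⟨d, rfl, hd₁⟩ := hcode d hd
    obtain ⟨x, rfl, hx₁, hx'⟩ := hmul ha₁ hq₁ hx
    obtain ⟨y, rfl, hy₁, hy'⟩ := hmul hq₁ hd₁ hy
    simp only [Option.isSome_iff_exists]
    constructor
    · rintro ⟨z, hz₁⟩
      obtain ⟨z, rfl, -, hz₁⟩ := hmul hx₁ hd₁ hz₁
      exact ⟨_, (mulOf_preeCode hT hN ha₁ hy₁).2 (.assoc hT hx' hy' hz₁)⟩
    · rintro ⟨z, hz₁⟩
      obtain ⟨z, rfl, -, hz₁⟩ := hmul ha₁ hy₁ hz₁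
      exact ⟨_, (mulOf_preeCode hT hN hx₁ hd₁).2 (.assoc' hT hx' hy' hz₁)⟩
  · intro a b d x y z ha hq hd hx hy hz
    obtain ⟨a, rfl, ha₁⟩ := hcode a ha
    obtain ⟨b, rfl, hq₁⟩ := hcode b hq
    obtain ⟨d, rfl, hd₁⟩ := hcode d hd
    obtain ⟨x, rfl, hx₁, hx'⟩ := hmul ha₁ hq₁ hx
    obtain ⟨y, rfl, hy₁, hy'⟩ := hmul hq₁ hd₁ hy
    obtain ⟨z, rfl, -, hz₁⟩ := hmul hx₁ hd₁ hz
    exact (mulOf_preeCode hT hN ha₁ hy₁).2 (.assoc hT hx' hy' hz₁)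

/-- An injective realization of a partial Latin square in a group gives an injective map from
its pree. -/
theorem injective_piOf {G : Type*} [Group G] (hT : IsLatin {τ | τ ∈ T}) (hN : 0 < N)
    (f : ℕ → G) (hf : ∀ τ ∈ T, f τ.1 * f τ.2.1 = f τ.2.2) (hinj : Set.InjOn f (Set.Iio N)) :
    Function.Injective (preeCode N T).piOf := by
  let F : El → G × Multiplicative ℤ
    | one => 1
    | row i => (f i, .ofAdd 1)
    | row' i => (f i, .ofAdd 1)⁻¹
    | col i => (f i, .ofAdd 2)
    | col' i => (f i, .ofAdd 2)⁻¹
    | sym i => (f i, .ofAdd 3)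
    | sym' i => (f i, .ofAdd 3)⁻¹
  have hFinv : ∀ a, F a.inv = (F a)⁻¹ := by
    rintro (_ | _) <;> simp [F, El.inv]
  have hF : ∀ {a b c}, Rel {τ | τ ∈ T} a b c → F a * F b = F c := by
    intro a b c h
    have key : ∀ {i j k}, (i, j, k) ∈ T → F (row i) * F (col j) = F (sym k) := fun h =>
      Prod.ext (hf _ h) rfl
    cases h with
    | one_mul => simp [F]
    | mul_one => simp [F]
    | mul_inv h => subst h; rw [hFinv, mul_inv_cancel]
    | row_col h => exact key h
    | sym_col' h => exact mul_inv_eq_iff_eq_mul.2 (key h).symm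
    | row'_sym h => exact inv_mul_eq_iff_eq_mul.2 (key h).symm
    | col'_row' h => exact (mul_inv_rev _ _).symm.trans (congrArg _ (key h))
    | @col_sym' i j k h =>
      change F (col j) * (F (sym k))⁻¹ = (F (row i))⁻¹
      rw [← key h]; group
    | @sym'_row i j k h =>
      change (F (sym k))⁻¹ * F (row i) = (F (col j))⁻¹
      rw [← key h]; group
  have hFinj : ∀ a b, a.idx < N → b.idx < N → F a = F b → a = b := by
    intro a b ha hb h
    have h₂ : Multiplicative.toAdd (F a).2 = Multiplicative.toAdd (F b).2 := by rw [h]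
    have h₁ : (F a).1 = (F b).1 := by rw [h]
    cases a <;> cases b <;> first
      | rfl
      | (congr 1; exact hinj ha hb h₁)
      | (congr 1; exact hinj ha hb (inv_injective h₁))
      | (exact absurd h₂ (by simp [F]))
  let dec : ℕ → El := Function.surjInv code_surjective
  have hdec : ∀ n, (dec n).code = n := Function.surjInv_eq code_surjective
  have hdec' : ∀ n : Fin (preeCode N T).size, (dec n).idx < N := fun n => by
    rw [← code_lt_iff hN, hdec]
    exact n.2
  have hrel : ∀ r ∈ (preeCode N T).relsOf, 
      FreeGroup.lift (fun n : Fin (preeCode N T).size => F (dec n)) r = 1 := by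
    rintro r ⟨a, b, d, h, rfl⟩
    simp only [map_mul, map_inv, FreeGroup.lift_apply_of]
    rw [mul_inv_eq_one]
    rw [← hdec a, ← hdec b, ← hdec d, mulOf_preeCode hT hN (hdec' a) (hdec' b)] at h
    exact hF h
  intro a b h
  have h' := congrArg (PresentedGroup.toGroup hrel) h
  simp only [PreeCode.piOf, PresentedGroup.toGroup.of] at h'
  have := congrArg El.code (hFinj _ _ (hdec' a) (hdec' b) h')
  rw [hdec, hdec] at this
  exact Fin.ext this

/-- If the canonical map of the pree of a partial Latin square is injective, the Latin square is
isotopic to a part of the multiplication table of a group. -/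
theorem exists_isotopy_of_injective (hT : IsLatin {τ | τ ∈ T}) (hN : 0 < N)
    (hb : ∀ τ ∈ T, τ.1 < N ∧ τ.2.1 < N ∧ τ.2.2 < N)
    (hinj : Function.Injective (preeCode N T).piOf) :
    ∃ α β γ : ℕ → PresentedGroup (preeCode N T).relsOf, (∀ τ ∈ T, α τ.1 * β τ.2.1 = γ τ.2.2) ∧
      Set.InjOn β (Set.Iio N) := by
  let F : El → PresentedGroup (preeCode N T).relsOf := fun a =>
    if h : a.code < (preeCode N T).size then (preeCode N T).piOf ⟨_, h⟩ else 1
  have hlt : ∀ a : El, a.idx < N → a.code < (preeCode N T).size := fun a => (code_lt_iff hN).2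
  refine ⟨fun i => F (row i), fun i => F (col i), fun i => F (sym i), fun τ hτ => ?_, ?_⟩
  · obtain ⟨h₁, h₂, h₃⟩ := hb τ hτ
    simp only [F, dif_pos (hlt (row τ.1) h₁), dif_pos (hlt (col τ.2.1) h₂),
      dif_pos (hlt (sym τ.2.2) h₃)]
    rw [← mul_inv_eq_one]
    exact PresentedGroup.one_of_mem ⟨_, _, _,
      (mulOf_preeCode (a := row τ.1) (b := col τ.2.1) hT hN h₁ h₂).2 (.row_col hτ), rfl⟩
  · intro i hi j hj h
    simp only [F, dif_pos (hlt (col i) hi), dif_pos (hlt (col j) hj)] at h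
    have := hinj h
    simpa [El.code] using this

end LatinPree

/-! ### Deciding commutation by partial Latin squares -/

/-- In a finitely presented group there is a finite set such that partial homomorphisms on it extend
to homomorphisms. -/
theorem PresentedGroup.exists_finite_extension {ι : Type} {rels : Set (FreeGroup ι)}
    (hrels : rels.Finite) {S : Set ι} (hS : S.Finite) :
    ∃ W : Set (PresentedGroup rels), W.Finite ∧ 1 ∈ W ∧ (∀ i ∈ S, PresentedGroup.of i ∈ W) ∧
      ∀ {G : Type} [Group G] (φ : PresentedGroup rels → G),
        (∀ u ∈ W, ∀ v ∈ W, u * v ∈ W → φ u * φ v = φ (u * v)) →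
        ∃ ψ : PresentedGroup rels →* G,
          ∀ i ∈ S, ψ (PresentedGroup.of i) = φ (PresentedGroup.of i) := by
  classical
  let J : Set ι := S ∪ ⋃ r ∈ rels, {i | i ∈ r.toWord.map Prod.fst}
  have hJ : J.Finite := hS.union (hrels.biUnion fun r _ => List.finite_toSet _)
  let W : Set (PresentedGroup rels) := {1} ∪ PresentedGroup.of '' J ∪
    (fun i => (PresentedGroup.of i)⁻¹) '' J ∪
    ⋃ r ∈ rels, (fun L => PresentedGroup.mk rels (FreeGroup.mk L)) '' {L | L ∈ r.toWord.inits}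
  have hW1 : (1 : PresentedGroup rels) ∈ W := .inl (.inl (.inl rfl))
  have hWof : ∀ i ∈ J, PresentedGroup.of i ∈ W := fun i hi => .inl (.inl (.inr ⟨i, hi, rfl⟩))
  have hWinv : ∀ i ∈ J, (PresentedGroup.of i : PresentedGroup rels)⁻¹ ∈ W := fun i hi =>
    .inl (.inr ⟨i, hi, rfl⟩)
  have hWpre : ∀ r ∈ rels, ∀ L, L <+: r.toWord → PresentedGroup.mk rels (FreeGroup.mk L) ∈ W :=
    fun r hr L hL => .inr (Set.mem_biUnion hr ⟨L, List.mem_inits _ _ |>.2 hL, rfl⟩)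
  refine ⟨W, ?_, hW1, fun i hi => hWof i (.inl hi), fun {G} _ φ hφ => ?_⟩
  · refine ((((Set.finite_singleton _).union (hJ.image _)).union (hJ.image _)).union ?_)
    exact hrels.biUnion fun r _ => (List.finite_toSet _).image _
  have hφ1 : φ 1 = 1 := by simpa using hφ 1 hW1 1 hW1 (by simpa using hW1)
  have hφinv : ∀ i ∈ J, φ (PresentedGroup.of i)⁻¹ = (φ (PresentedGroup.of i))⁻¹ := fun i hi => by
    have := hφ _ (hWinv i hi) _ (hWof i hi) (by simpa using hW1)
    rw [inv_mul_cancel, hφ1] at this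
    exact eq_inv_of_mul_eq_one_left this
  let g : ι → G := fun i => φ (PresentedGroup.of i)
  have hpre : ∀ r ∈ rels, ∀ L, L <+: r.toWord →
      FreeGroup.lift g (FreeGroup.mk L) = φ (PresentedGroup.mk rels (FreeGroup.mk L)) := by
    intro r hr L
    induction L using List.reverseRecOn with
    | nil => intro _; exact (map_one (FreeGroup.lift g)).trans hφ1.symm
    | append_singleton L a ih =>
      intro hL
      have hL' : L <+: r.toWord := (List.prefix_append _ _).trans hL
      have ha : a.1 ∈ J := .inr (Set.mem_biUnion hr
        (List.mem_map_of_mem (hL.subset (by simp))))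
      have hmul : FreeGroup.mk (L ++ [a]) = FreeGroup.mk L * FreeGroup.mk [a] :=
        FreeGroup.mul_mk.symm
      have hW := hWpre r hr _ hL
      rw [hmul, map_mul] at hW
      rw [hmul, map_mul, map_mul, ih hL']
      obtain ⟨i, _ | _⟩ := a
      · have hi : FreeGroup.mk [(i, false)] = (FreeGroup.of i)⁻¹ := rfl
        rw [hi, map_inv] at hW
        rw [hi, map_inv, map_inv, FreeGroup.lift_apply_of, ← hφinv i ha]
        exact hφ _ (hWpre r hr _ hL') _ (hWinv i ha) hW
      · have hi : FreeGroup.mk [(i, true)] = FreeGroup.of i := rfl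
        rw [hi] at hW
        rw [hi, FreeGroup.lift_apply_of]
        exact hφ _ (hWpre r hr _ hL') _ (hWof i ha) hW
  have hlift : ∀ r ∈ rels, FreeGroup.lift g r = 1 := fun r hr => by
    have := hpre r hr _ List.prefix_rfl
    rwa [FreeGroup.mk_toWord, PresentedGroup.one_of_mem hr, hφ1] at this
  exact ⟨PresentedGroup.toGroup hlift, fun i _ => PresentedGroup.toGroup.of hlift⟩

/-- A finite part of the multiplication table of a group, containing the elements `x`, `t` and `k`,
such that partial homomorphisms on it extend to homomorphisms. -/
structure FiniteTable {U : Type} [Group U] (x t k : U) where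
  size : ℕ
  elt : ℕ → U
  triples : List (ℕ × ℕ × ℕ)
  one : ℕ
  ix : ℕ
  it : ℕ
  ik : ℕ
  one_lt : one < size
  ix_lt : ix < size
  it_lt : it < size
  ik_lt : ik < size
  elt_one : elt one = 1
  elt_ix : elt ix = x
  elt_it : elt it = t
  elt_ik : elt ik = k
  injOn : Set.InjOn elt (Set.Iio size)
  mem_triples : ∀ {a b c}, (a, b, c) ∈ triples ↔
    a < size ∧ b < size ∧ c < size ∧ elt a * elt b = elt c
  exists_hom : ∀ {G : Type} [Group G] (φ : ℕ → G),
    (∀ {a b c}, (a, b, c) ∈ triples → φ a * φ b = φ c) →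
    ∃ ψ : U →* G, ψ x = φ ix ∧ ψ t = φ it ∧ ψ k = φ ik

theorem FiniteTable.nonempty {ι : Type} {rels : Set (FreeGroup ι)} (hrels : rels.Finite)
    (i j l : ι) : Nonempty (FiniteTable (PresentedGroup.of i : PresentedGroup rels)
      (PresentedGroup.of j) (PresentedGroup.of l)) := by
  classical
  obtain ⟨W, hW, hW1, hWS, hext⟩ := PresentedGroup.exists_finite_extension hrels
    (S := {i, j, l}) (by simp)
  have := hW.to_subtype
  obtain ⟨M, ⟨e⟩⟩ := Finite.exists_equiv_fin W
  let elt : ℕ → PresentedGroup rels := fun n => if h : n < M then e.symm ⟨n, h⟩ else 1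
  let idx : PresentedGroup rels → ℕ := fun u => if h : u ∈ W then e ⟨u, h⟩ else 0
  have hidx : ∀ u ∈ W, idx u < M := fun u hu => by simp [idx, hu]
  have helt : ∀ u ∈ W, elt (idx u) = u := fun u hu => by simp [elt, idx, hu]
  have hi := hWS i (by simp)
  have hj := hWS j (by simp)
  have hl := hWS l (by simp)
  refine ⟨⟨M, elt, (List.range M ×ˢ (List.range M ×ˢ
    List.range (M))).filter fun τ => elt τ.1 * elt τ.2.1 = elt τ.2.2,
    idx 1, idx (.of i), idx (.of j), idx (.of l), hidx _ hW1, hidx _ hi, hidx _ hj, hidx _ hl,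
    helt _ hW1, helt _ hi, helt _ hj, helt _ hl, ?_, ?_, ?_⟩⟩
  · intro a ha b hb hab
    have ha' : a < M := ha
    have hb' : b < M := hb
    simpa [elt, ha', hb', Subtype.ext_iff.symm] using hab
  · intro a b c
    simp [List.mem_filter, and_assoc]
  · intro G _ φ hφ
    obtain ⟨ψ, hψ⟩ := hext (fun u => φ (idx u)) fun u hu v hv huv => hφ (by
      simp [List.mem_filter, helt, hu, hv, huv, hidx])
    exact ⟨ψ, hψ i (by simp), hψ j (by simp), hψ l (by simp)⟩

section Chain

variable {U : Type*} [Group U]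

/-- A sequence from `1` to the conjugate of `t` by `x ^ z` whose consecutive terms differ by a left
multiplication by `x` or `t`. -/
def chain (x t : U) (z i : ℕ) : U :=
  if i ≤ z then x ^ (-i : ℤ) else x ^ (i - z - 1 : ℤ) * t * x ^ (-z : ℤ)

variable (x t : U) {z i : ℕ}

theorem chain_zero : chain x t z 0 = 1 := by simp [chain]

theorem mul_chain_of_lt (h : i < z) : x * chain x t z (i + 1) = chain x t z i := by
  rw [chain, chain, if_pos (Nat.succ_le_of_lt h), if_pos h.le, ← zpow_one_add]
  congr 1; push_cast; ring

theorem mul_chain_self : t * chain x t z z = chain x t z (z + 1) := by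
  simp [chain]

theorem mul_chain_add : x * chain x t z (z + 1 + i) = chain x t z (z + 2 + i) := by
  rw [chain, chain, if_neg (by omega), if_neg (by omega), ← mul_assoc, ← mul_assoc, ← zpow_one_add]
  congr 3; push_cast; ring

theorem chain_last : chain x t z (2 * z + 1) = x ^ (z : ℤ) * t * (x ^ (z : ℤ))⁻¹ := by
  rw [chain, if_neg (by omega), ← zpow_neg]
  congr 3; push_cast; ring

theorem eq_chain_mul {x t : U} {y : ℕ → U} (h₁ : ∀ i < z, x * y (i + 1) = y i)
    (h₂ : t * y z = y (z + 1)) (h₃ : ∀ i < z, x * y (z + 1 + i) = y (z + 2 + i)) :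
    y (2 * z + 1) = x ^ (z : ℤ) * t * (x ^ (z : ℤ))⁻¹ * y 0 := by
  have k₁ : ∀ i ≤ z, x ^ i * y i = y 0 := fun i => by
    induction i with
    | zero => simp
    | succ i ih => intro hi; rw [pow_succ, mul_assoc, h₁ i hi, ih (by omega)]
  have k₂ : ∀ i ≤ z, y (z + 1 + i) = x ^ i * y (z + 1) := fun i => by
    induction i with
    | zero => simp
    | succ i ih =>
      intro hi
      rw [pow_succ', mul_assoc, ← ih (by omega), h₃ i hi]
      congr 1; ring
  rw [show 2 * z + 1 = z + 1 + z by ring, k₂ z le_rfl, ← h₂, ← k₁ z le_rfl, zpow_natCast]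
  group

end Chain

namespace FiniteTable

open LatinPree

variable {U : Type} [Group U] {x t k : U} (A : FiniteTable x t k) (z : ℕ)

/-- The number of rows of the partial Latin square of a finite table. -/
def order : ℕ := A.size + 4 * z + 5

/-- The entries recording the multiplication by `x` and `t` along the two chains from `u` to
`x ^ z * t * x ^ (-z) * u`, for `u = 1` and `u = k`. -/
def chainSteps : List (ℕ × ℕ × ℕ) :=
  (List.range z).flatMap fun i =>
    [(A.ix, A.size + i + 1, A.size + i),
    (A.ix, A.size + z + 1 + i, A.size + z + 2 + i),
    (A.ix, A.size + 2 * z + 2 + i + 1, A.size + 2 * z + 2 + i),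
    (A.ix, A.size + 3 * z + 3 + i, A.size + 3 * z + 4 + i)]

/-- The partial Latin square which embeds in a group if and only if `k` does not commute with
`x ^ z * t * x ^ (-z)`. -/
def square : List (ℕ × ℕ × ℕ) :=
  A.triples ++ ((List.range (4 * z + 5)).map fun i => (A.one, A.size + i, A.size + i)) ++
    A.chainSteps z ++
    [(A.it, A.size + z, A.size + z + 1),
    (A.it, A.size + 3 * z + 2, A.size + 3 * z + 3),
    (A.ik, A.size + 2 * z + 1, A.size + 4 * z + 4),
    (A.ik, A.size, A.size + 2 * z + 2)]

/-- The ways in which an entry of `A.square z` arises. -/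
inductive Entry : ℕ → ℕ → ℕ → Prop
  | table {a b c} (h : (a, b, c) ∈ A.triples) : Entry a b c
  | one {b} (h : A.size ≤ b) (h' : b < A.order z) : Entry A.one b b
  | x_left {i} (h : i < z) : Entry A.ix (A.size + i + 1) (A.size + i)
  | x_right {i} (h : i < z) : Entry A.ix (A.size + z + 1 + i) (A.size + z + 2 + i)
  | x_left' {i} (h : i < z) : Entry A.ix (A.size + 2 * z + 2 + i + 1) (A.size + 2 * z + 2 + i)
  | x_right' {i} (h : i < z) : Entry A.ix (A.size + 3 * z + 3 + i) (A.size + 3 * z + 4 + i)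
  | t : Entry A.it (A.size + z) (A.size + z + 1)
  | t' : Entry A.it (A.size + 3 * z + 2) (A.size + 3 * z + 3)
  | k : Entry A.ik (A.size + 2 * z + 1) (A.size + 4 * z + 4)
  | k' : Entry A.ik A.size (A.size + 2 * z + 2)

variable {z} {a b c : ℕ}

theorem mem_square : (a, b, c) ∈ A.square z ↔ A.Entry z a b c := by
  constructor
  · intro h
    simp only [square, chainSteps, List.mem_append, List.mem_map, List.mem_range, List.mem_flatMap,
      List.mem_cons, List.not_mem_nil, or_false, Prod.mk.injEq] at h
    rcases h with ((h | ⟨i, hi, rfl, rfl, rfl⟩) | ⟨i, hi, h⟩) | h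
    · exact .table h
    · exact .one (by omega) (by simp only [order]; omega)
    · rcases h with ⟨rfl, rfl, rfl⟩ | ⟨rfl, rfl, rfl⟩ | ⟨rfl, rfl, rfl⟩ | ⟨rfl, rfl, rfl⟩
      exacts [.x_left hi, .x_right hi, .x_left' hi, .x_right' hi]
    · rcases h with ⟨rfl, rfl, rfl⟩ | ⟨rfl, rfl, rfl⟩ | ⟨rfl, rfl, rfl⟩ | ⟨rfl, rfl, rfl⟩
      exacts [.t, .t', .k, .k']
  · intro h
    simp only [square, chainSteps, List.mem_append, List.mem_map, List.mem_range, List.mem_flatMap,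
      List.mem_cons, List.not_mem_nil, or_false]
    cases h with
    | table h => exact .inl (.inl (.inl h))
    | one h h' =>
      obtain ⟨i, rfl⟩ := Nat.exists_eq_add_of_le h
      simp only [order] at h'
      exact .inl (.inl (.inr ⟨i, by omega, rfl⟩))
    | x_left h | x_right h | x_left' h | x_right' h => exact .inl (.inr ⟨_, h, by simp⟩)
    | t | t' | k | k' => exact .inr (by simp)

theorem lt_order (τ : ℕ × ℕ × ℕ) (hτ : τ ∈ A.square z) :
    τ.1 < A.order z ∧ τ.2.1 < A.order z ∧ τ.2.2 < A.order z := by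
  obtain ⟨a, b, c⟩ := τ
  have := A.one_lt
  have := A.ix_lt
  have := A.it_lt
  have := A.ik_lt
  simp only [order]
  cases A.mem_square.1 hτ with
  | table h => have := A.mem_triples.1 h; omega
  | one h h' => simp only [order] at h'; omega
  | _ => omega

theorem row_lt (h : A.Entry z a b c) : a < A.size := by
  cases h with
  | table h => exact (A.mem_triples.1 h).1
  | one => exact A.one_lt
  | x_left | x_right | x_left' | x_right' => exact A.ix_lt
  | t | t' => exact A.it_lt
  | k | k' => exact A.ik_lt

theorem primrec_order : Primrec A.order := by
  unfold order
  exact Primrec.nat_add.comp (Primrec.nat_add.comp (.const _)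
    (Primrec.nat_mul.comp (.const 4) .id)) (.const 5)

theorem primrec_square : Primrec A.square := by
  have add {α : Type} [Primcodable α] {f g : α → ℕ} (hf : Primrec f) (hg : Primrec g) :
    Primrec fun a => f a + g a := Primrec.nat_add.comp hf hg
  have mul {α : Type} [Primcodable α] (c : ℕ) {f : α → ℕ} (hf : Primrec f) :
    Primrec fun a => c * f a := Primrec.nat_mul.comp (.const c) hf
  have cons {α : Type} [Primcodable α] {a : ℕ} {b c : α → ℕ} {l : α → List (ℕ × ℕ × ℕ)}
      (hb : Primrec b) (hc : Primrec c) (hl : Primrec l) : Primrec fun n => (a, b n, c n) :: l n :=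
    Primrec.list_cons.comp (.pair (.const a) (.pair hb hc)) hl
  have shift {α : Type} [Primcodable α] (c d e : ℕ) {f g : α → ℕ} (hf : Primrec f)
      (hg : Primrec g) : Primrec fun a => c + d * f a + e + g a :=
    add (add (add (.const c) (mul d hf)) (.const e)) hg
  have hone : Primrec fun n => (List.range (4 * n + 5)).map fun i =>
      (A.one, A.size + i, A.size + i) := by
    have h : Primrec fun p : ℕ × ℕ => A.size + p.2 := add (.const _) .snd
    exact Primrec.list_map (Primrec.list_range.comp (add (mul 4 .id) (.const 5)))
      (Primrec.to₂ (.pair (.const _) (.pair h h)))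
  have hsteps : Primrec (A.chainSteps) := by
    have h : Primrec fun p : ℕ × ℕ =>
      [(A.ix, A.size + p.2 + 1, A.size + p.2),
      (A.ix, A.size + p.1 + 1 + p.2, A.size + p.1 + 2 + p.2),
      (A.ix, A.size + 2 * p.1 + 2 + p.2 + 1, A.size + 2 * p.1 + 2 + p.2),
      (A.ix, A.size + 3 * p.1 + 3 + p.2, A.size + 3 * p.1 + 4 + p.2)] :=
      cons (add (add (.const _) .snd) (.const 1)) (add (.const _) .snd) <|
      cons (add (add (add (.const _) .fst) (.const 1)) .snd)
        (add (add (add (.const _) .fst) (.const 2)) .snd) <|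
      cons (add (shift _ 2 2 .fst .snd) (.const 1)) (shift _ 2 2 .fst .snd) <|
      cons (shift _ 3 3 .fst .snd) (shift _ 3 4 .fst .snd) (.const [])
    exact Primrec.list_flatMap Primrec.list_range h.to₂
  have hlast : Primrec fun n =>
      [(A.it, A.size + n, A.size + n + 1),
      (A.it, A.size + 3 * n + 2, A.size + 3 * n + 3),
      (A.ik, A.size + 2 * n + 1, A.size + 4 * n + 4),
      (A.ik, A.size, A.size + 2 * n + 2)] :=
    cons (add (.const _) .id) (add (add (.const _) .id) (.const 1)) <|
    cons (shift _ 3 2 .id (.const 0)) (shift _ 3 3 .id (.const 0)) <|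
    cons (shift _ 2 1 .id (.const 0)) (shift _ 4 4 .id (.const 0)) <|
    cons (.const _) (shift _ 2 2 .id (.const 0)) (.const [])
  exact Primrec.list_append.comp
    (Primrec.list_append.comp (Primrec.list_append.comp (.const _) hone) hsteps) hlast

variable (z) in
/-- The realization of `A.square z` in `U × ℤ`. -/
def val (n : ℕ) : U × Multiplicative ℤ :=
  if n < A.size then (A.elt n, 1) else
    (if n < A.size + 2 * z + 2 then chain x t z (n - A.size)
    else if n < A.size + 4 * z + 4 then chain x t z (n - A.size - (2 * z + 2)) * k
    else k * chain x t z (2 * z + 1), .ofAdd 1)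

variable {n m i : ℕ}

theorem val_of_lt (h : n < A.size) : A.val z n = (A.elt n, 1) := if_pos h

theorem val_chain (h : n = A.size + i) (hi : i ≤ 2 * z + 1) :
    A.val z n = (chain x t z i, .ofAdd 1) := by
  subst h
  rw [val, if_neg (by omega), if_pos (by omega), Nat.add_sub_cancel_left]

theorem val_chain_mul (h : n = A.size + 2 * z + 2 + i) (hi : i ≤ 2 * z + 1) :
    A.val z n = (chain x t z i * k, .ofAdd 1) := by
  subst h
  rw [val, if_neg (by omega), if_neg (by omega), if_pos (by omega),
    show A.size + 2 * z + 2 + i - A.size - (2 * z + 2) = i by omega]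

theorem val_last : A.val z (A.size + 4 * z + 4) = (k * chain x t z (2 * z + 1), .ofAdd 1) := by
  rw [val, if_neg (by omega), if_neg (by omega), if_neg (by omega)]

theorem val_mul_aux {u v : U} (ha : a < A.size) (hb : A.val z b = (u, .ofAdd 1))
    (hc : A.val z c = (v, .ofAdd 1)) (h : A.elt a * u = v) :
    A.val z a * A.val z b = A.val z c := by
  rw [A.val_of_lt ha, hb, hc, ← h, Prod.mk_mul_mk, one_mul]

theorem val_mul (h : A.Entry z a b c) : A.val z a * A.val z b = A.val z c := by
  cases h with
  | table h =>
    obtain ⟨ha, hb, hc, h⟩ := A.mem_triples.1 h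
    rw [A.val_of_lt ha, A.val_of_lt hb, A.val_of_lt hc, ← h, Prod.mk_mul_mk, one_mul]
  | one => rw [A.val_of_lt A.one_lt, A.elt_one]; exact one_mul _
  | @x_left i h =>
    refine A.val_mul_aux A.ix_lt (A.val_chain (i := i + 1) (by ring) (by omega))
      (A.val_chain (i := i) rfl (by omega)) ?_
    rw [A.elt_ix, mul_chain_of_lt x t h]
  | @x_right i h =>
    refine A.val_mul_aux A.ix_lt (A.val_chain (i := z + 1 + i) (by ring) (by omega))
      (A.val_chain (i := z + 2 + i) (by ring) (by omega)) ?_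
    rw [A.elt_ix, mul_chain_add]
  | @x_left' i h =>
    refine A.val_mul_aux A.ix_lt (A.val_chain_mul (i := i + 1) (by ring) (by omega))
      (A.val_chain_mul rfl (by omega)) ?_
    rw [A.elt_ix, ← mul_assoc, mul_chain_of_lt x t h]
  | @x_right' i h =>
    refine A.val_mul_aux A.ix_lt (A.val_chain_mul (i := z + 1 + i) (by ring) (by omega))
      (A.val_chain_mul (i := z + 2 + i) (by ring) (by omega)) ?_
    rw [A.elt_ix, ← mul_assoc, mul_chain_add]
  | t =>
    refine A.val_mul_aux A.it_lt (A.val_chain rfl (by omega))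
      (A.val_chain (i := z + 1) (by ring) (by omega)) ?_
    rw [A.elt_it, mul_chain_self]
  | t' =>
    refine A.val_mul_aux A.it_lt (A.val_chain_mul (i := z) (by ring) (by omega))
      (A.val_chain_mul (i := z + 1) (by ring) (by omega)) ?_
    rw [A.elt_it, ← mul_assoc, mul_chain_self]
  | k =>
    refine A.val_mul_aux A.ik_lt (A.val_chain (i := 2 * z + 1) (by ring) le_rfl) A.val_last ?_
    rw [A.elt_ik]
  | k' =>
    refine A.val_mul_aux A.ik_lt (A.val_chain (i := 0) rfl (by omega))
      (A.val_chain_mul (i := 0) rfl (by omega)) ?_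
    rw [A.elt_ik, chain_zero, mul_one, one_mul]

/-- The elements `x`, `t` and `k` are independent in the abelianization of `U`. -/
def Independent (x t k : U) : Prop :=
  ∃ D : U →* Multiplicative (ℤ × ℤ × ℤ),
    D x = .ofAdd (1, 0, 0) ∧ D t = .ofAdd (0, 1, 0) ∧ D k = .ofAdd (0, 0, 1)

section Degree

variable {D : U →* Multiplicative (ℤ × ℤ × ℤ)}

theorem degree_chain (hx : D x = .ofAdd (1, 0, 0)) (ht : D t = .ofAdd (0, 1, 0)) :
    D (chain x t z i) =
      .ofAdd (if i ≤ z then (-(i : ℤ), 0, 0) else ((i : ℤ) - 2 * z - 1, 1, 0)) := by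
  rw [chain]
  split_ifs with h
  · rw [map_zpow, hx, ← ofAdd_zsmul]; simp
  · rw [map_mul, map_mul, map_zpow, map_zpow, hx, ht, ← ofAdd_zsmul, ← ofAdd_zsmul, ← ofAdd_add,
      ← ofAdd_add]
    simp only [Prod.smul_mk, Prod.mk_add_mk, smul_eq_mul]
    congr 2 <;> ring_nf

theorem degree_val (hx : D x = .ofAdd (1, 0, 0)) (ht : D t = .ofAdd (0, 1, 0))
    (hk : D k = .ofAdd (0, 0, 1)) (hn : A.size ≤ n) (hn' : n < A.order z) :
    ∃ d₁ d₂ d₃ : ℤ, D (A.val z n).1 = .ofAdd (d₁, d₂, d₃) ∧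
      (n ≤ A.size + z ∧ d₁ = A.size - n ∧ d₂ = 0 ∧ d₃ = 0 ∨
      A.size + z < n ∧ n < A.size + 2 * z + 2 ∧ d₁ = n - A.size - 2 * z - 1 ∧ d₂ = 1 ∧ d₃ = 0 ∨
      A.size + 2 * z + 2 ≤ n ∧ n ≤ A.size + 3 * z + 2 ∧ d₁ = A.size + 2 * z + 2 - n ∧ d₂ = 0 ∧
        d₃ = 1 ∨
      A.size + 3 * z + 2 < n ∧ n < A.size + 4 * z + 4 ∧ d₁ = n - A.size - 4 * z - 3 ∧ d₂ = 1 ∧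
        d₃ = 1 ∨
      n = A.size + 4 * z + 4 ∧ d₁ = 0 ∧ d₂ = 1 ∧ d₃ = 1) := by
  have hchain := fun i => degree_chain (z := z) (i := i) hx ht
  simp only [order] at hn'
  rcases lt_or_ge n (A.size + 2 * z + 2) with h | h
  · obtain ⟨i, rfl⟩ := Nat.exists_eq_add_of_le hn
    rw [A.val_chain rfl (by omega), hchain]
    split_ifs <;> exact ⟨_, _, _, rfl, by omega⟩
  rcases lt_or_ge n (A.size + 4 * z + 4) with h' | h'
  · obtain ⟨i, rfl⟩ := Nat.exists_eq_add_of_le h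
    rw [A.val_chain_mul rfl (by omega), map_mul, hchain, hk, ← ofAdd_add]
    split_ifs <;> exact ⟨_, _, _, rfl, by dsimp only [Prod.mk_add_mk]; omega⟩
  · obtain rfl : n = A.size + 4 * z + 4 := by omega
    rw [A.val_last, map_mul, hchain, hk, ← ofAdd_add]
    rw [if_neg (by omega)]
    exact ⟨_, _, _, rfl, by dsimp only [Prod.mk_add_mk]; omega⟩

end Degree

theorem eq_or_of_val_eq (hD : Independent x t k) (hn : n < A.order z) (hm : m < A.order z)
    (h : A.val z n = A.val z m) : n = m ∨
      n = A.size + 4 * z + 4 ∧ m = A.size + 4 * z + 3 ∨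
      n = A.size + 4 * z + 3 ∧ m = A.size + 4 * z + 4 := by
  have hval : ∀ {l}, A.size ≤ l → (A.val z l).2 = .ofAdd 1 := fun {l} hl => by
    rw [val, if_neg (by omega)]
  rcases lt_or_ge n A.size with hn₁ | hn₁ <;> rcases lt_or_ge m A.size with hm₁ | hm₁
  · rw [A.val_of_lt hn₁, A.val_of_lt hm₁] at h
    exact .inl (A.injOn hn₁ hm₁ (congrArg Prod.fst h))
  · have := hval hm₁
    rw [← h, A.val_of_lt hn₁] at this
    exact absurd (show (1 : Multiplicative ℤ) = .ofAdd 1 from this) (by decide)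
  · have := hval hn₁
    rw [h, A.val_of_lt hm₁] at this
    exact absurd (show (1 : Multiplicative ℤ) = .ofAdd 1 from this) (by decide)
  · obtain ⟨D, hx, ht, hk⟩ := hD
    obtain ⟨d₁, d₂, d₃, h₁, h₂⟩ := A.degree_val hx ht hk hn₁ hn
    obtain ⟨e₁, e₂, e₃, h₃, h₄⟩ := A.degree_val hx ht hk hm₁ hm
    rw [h, h₃] at h₁
    have := Multiplicative.ofAdd.injective h₁
    simp only [Prod.mk.injEq] at this
    omega

theorem injOn_val (hD : Independent x t k)
    (hcomm : ¬ Commute k (x ^ (z : ℤ) * t * (x ^ (z : ℤ))⁻¹)) :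
    Set.InjOn (A.val z) (Set.Iio (A.order z)) := by
  have hne : A.val z (A.size + 4 * z + 4) ≠ A.val z (A.size + 4 * z + 3) := by
    rw [A.val_last, A.val_chain_mul (i := 2 * z + 1) (by ring) le_rfl, chain_last]
    exact fun h => hcomm (congrArg Prod.fst h)
  intro n hn m hm h
  rcases A.eq_or_of_val_eq hD hn hm h with h' | ⟨rfl, rfl⟩ | ⟨rfl, rfl⟩
  exacts [h', absurd h hne, absurd h.symm hne]

theorem col_of_sym_last (h : A.Entry z a b c) :
    (b = A.size + 4 * z + 4 → c = A.size + 4 * z + 4) ∧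
    (b = A.size + 4 * z + 3 → c = A.size + 4 * z + 3) ∧
    (c = A.size + 4 * z + 4 → b = A.size + 4 * z + 4 ∨ b = A.size + 2 * z + 1) ∧
    (c = A.size + 4 * z + 3 → b ≠ A.size + 4 * z + 4 ∧ b ≠ A.size + 2 * z + 1) := by
  cases h with
  | table h => have := A.mem_triples.1 h; omega
  | _ => omega

theorem isLatin (hD : Independent x t k) : IsLatin {τ | τ ∈ A.square z} where
  sym_eq {a b c c'} h h' := by
    have hlt : c < A.order z := (A.lt_order _ h).2.2
    have hlt' : c' < A.order z := (A.lt_order _ h').2.2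
    replace h := A.mem_square.1 h
    replace h' := A.mem_square.1 h'
    have := A.eq_or_of_val_eq hD hlt hlt' ((A.val_mul h).symm.trans (A.val_mul h'))
    have := A.col_of_sym_last h
    have := A.col_of_sym_last h'
    omega
  col_eq {a b b' c} h h' := by
    have hlt : b < A.order z := (A.lt_order _ h).2.1
    have hlt' : b' < A.order z := (A.lt_order _ h').2.1
    replace h := A.mem_square.1 h
    replace h' := A.mem_square.1 h'
    have := A.eq_or_of_val_eq hD hlt hlt'
      (mul_left_cancel ((A.val_mul h).trans (A.val_mul h').symm))
    have := A.col_of_sym_last h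
    have := A.col_of_sym_last h'
    omega
  row_eq {a a' b c} h h' := by
    have hlt : a < A.order z := (A.lt_order _ h).1
    have hlt' : a' < A.order z := (A.lt_order _ h').1
    replace h := A.mem_square.1 h
    replace h' := A.mem_square.1 h'
    have := A.eq_or_of_val_eq hD hlt hlt'
      (mul_right_cancel ((A.val_mul h).trans (A.val_mul h').symm))
    have := A.row_lt h
    have := A.row_lt h'
    omega

/-- If the pree of `A.square z` embeds in its universal group, then `k` does not commute with
`x ^ z * t * x ^ (-z)`. -/
theorem not_commute_of_isotopy {G : Type} [Group G] {α β γ : ℕ → G}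
    (h : ∀ τ ∈ A.square z, α τ.1 * β τ.2.1 = γ τ.2.2) (hβ : Set.InjOn β (Set.Iio (A.order z))) :
    ¬ Commute k (x ^ (z : ℤ) * t * (x ^ (z : ℤ))⁻¹) := by
  have h' : ∀ {a b c}, A.Entry z a b c → α a * β b = γ c := fun hE => h _ (A.mem_square.2 hE)
  have h₀ : ∀ {a b c}, (a, b, c) ∈ A.triples → α a * β b = γ c := fun hE => h' (.table hE)
  obtain ⟨ψ, hx, ht, hk⟩ := A.exists_hom (fun a => (α A.one)⁻¹ * α a) fun {a b c} habc => by
    obtain ⟨ha, hb, hc, -⟩ := A.mem_triples.1 habc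
    have h₁ := h₀ habc
    have h₂ : α A.one * β b = γ b :=
      h₀ (A.mem_triples.2 ⟨A.one_lt, hb, hb, by rw [A.elt_one, one_mul]⟩)
    have h₃ : α b * β A.one = γ b :=
      h₀ (A.mem_triples.2 ⟨hb, A.one_lt, hb, by rw [A.elt_one, mul_one]⟩)
    have h₄ : α c * β A.one = γ c :=
      h₀ (A.mem_triples.2 ⟨hc, A.one_lt, hc, by rw [A.elt_one, mul_one]⟩)
    rw [eq_mul_inv_of_mul_eq h₄, ← h₁, eq_mul_inv_of_mul_eq h₃, ← h₂]
    group
  have hstep : ∀ {a b c}, A.Entry z a b c → A.size ≤ c → c < A.order z →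
      (α A.one)⁻¹ * α a * β b = β c := fun {a b c} hE hc hc' => by
    rw [mul_assoc, h' hE, ← h' (.one hc hc'), inv_mul_cancel_left]
  have hlt : ∀ {n}, n < 4 * z + 5 → A.size + n < A.order z := fun {n} hn => by
    simp only [order]; omega
  intro hcomm
  have hF := eq_chain_mul (x := ψ x) (t := ψ t) (z := z) (y := fun i => β (A.size + i))
    (fun i hi => by rw [hx]; exact hstep (.x_left hi) (by omega) (hlt (by omega)))
    (by rw [ht]; exact hstep .t (by omega) (hlt (by omega)))
    (fun i hi => by
      rw [hx]
      have := hstep (.x_right hi) (by omega) (by simp only [order]; omega)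
      simpa only [add_assoc] using this)
  have hF' := eq_chain_mul (x := ψ x) (t := ψ t) (z := z) (y := fun i => β (A.size + 2 * z + 2 + i))
    (fun i hi => by
      rw [hx]; exact hstep (.x_left' hi) (by omega) (by simp only [order]; omega))
    (by
      have := hstep .t' (by omega) (by simp only [order]; omega)
      rw [ht]
      convert this using 2 <;> ring_nf)
    (fun i hi => by
      have := hstep (.x_right' hi) (by omega) (by simp only [order]; omega)
      rw [hx]
      convert this using 2 <;> ring_nf)
  have hk₁ := hstep .k (by omega) (by simp only [order]; omega)
  have hk₂ := hstep .k' (by omega) (by simp only [order]; omega)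
  simp only [add_zero] at hF hF'
  have hψ := congrArg ψ hcomm.eq
  simp only [map_mul, map_inv, map_zpow] at hψ
  have hpq : β (A.size + 4 * z + 4) = β (A.size + 4 * z + 3) := by
    rw [← hk₁, ← hk, show A.size + 2 * z + 1 = A.size + (2 * z + 1) by ring, hF, ← mul_assoc, hψ,
      show A.size + 4 * z + 3 = A.size + 2 * z + 2 + (2 * z + 1) by ring, hF', ← hk₂, ← hk,
      ← mul_assoc]
  have := @hβ (A.size + 4 * z + 4) (by simp only [order, Set.mem_Iio]; omega)
    (A.size + 4 * z + 3) (by simp only [order, Set.mem_Iio]; omega) hpq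
  omega

theorem order_pos : 0 < A.order z := by simp [order]

theorem isValid (hD : Independent x t k) : (preeCode (A.order z) (A.square z)).IsValid :=
  isValid_preeCode (A.isLatin hD) A.order_pos A.lt_order

theorem injective_piOf_iff (hD : Independent x t k) :
    Function.Injective (preeCode (A.order z) (A.square z)).piOf ↔
      ¬ Commute k (x ^ (z : ℤ) * t * (x ^ (z : ℤ))⁻¹) := by
  constructor
  · intro h
    obtain ⟨α, β, γ, h₁, h₂⟩ :=
      exists_isotopy_of_injective (A.isLatin hD) A.order_pos A.lt_order h
    exact A.not_commute_of_isotopy h₁ h₂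
  · intro h
    exact injective_piOf (A.isLatin hD) A.order_pos (A.val z)
      (fun _ hτ => A.val_mul (A.mem_square.1 hτ)) (A.injOn_val hD h)

end FiniteTable

open PullRule in
theorem PullRule.RuleGroup.independent {State : Type} (R : Set (PullRule State)) (q₁ q₀ : State) :
    FiniteTable.Independent (PresentedGroup.of .x : RuleGroup R q₁) (PresentedGroup.of .t)
      (PresentedGroup.of (.k q₀)) := by
  let g : Gen State → Multiplicative (ℤ × ℤ × ℤ)
    | .x => .ofAdd (1, 0, 0)
    | .t => .ofAdd (0, 1, 0)
    | .k _ => .ofAdd (0, 0, 1)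
    | _ => 1
  have hg := compatible_of_commGroup R q₁ g
  exact ⟨hg.toHom, hg.toHom_of _, hg.toHom_of _, hg.toHom_of _⟩

/-- It is undecidable whether the canonical map from a finite pree to its
universal group is an embedding: there is no computable function which, given a finite pree
encoded as a partial multiplication table together with its identity and inverse function,
decides whether the canonical map `π : P → U(P)` is injective. -/
theorem pree_embedding_undecidable :
    ¬ ∃ f : PreeCode → Bool, Computable f ∧
      ∀ c : PreeCode, c.IsValid → (f c = true ↔ Function.Injective c.piOf) := by
  rintro ⟨f, hf, hspec⟩
  obtain ⟨R, q₁, q₀, hR, hm, hundec⟩ := CounterProgram.exists_undecidable_forced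
  obtain ⟨A⟩ := FiniteTable.nonempty
    (PullRule.finite_relators hR q₁ FreeGroup.of) .x .t (.k q₀)
  have hD := PullRule.RuleGroup.independent R q₁ q₀
  have hiff : ∀ n : ℕ, (!f (LatinPree.preeCode (A.order n) (A.square n))) = true ↔
      PullRule.Forced R q₁ q₀ n := fun n => by
    rw [← PullRule.commute_iff_forced hm, PullRule.conjT, ← not_iff_not,
      ← A.injective_piOf_iff hD, ← hspec _ (A.isValid hD)]
    simp
  exact hundec (ComputablePred.computable_iff.2 ⟨_, Primrec.not.to_comp.comp
    (hf.comp (LatinPree.primrec_preeCode A.primrec_order A.primrec_square).to_comp),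
    funext fun n => propext (hiff n).symm⟩)
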